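/- arXiv:1006.2523 — 3 statements merged into one kernel-verified Lean document; each statement's English description precedes it below -/
import Mathlib

section
/- Let X be a coloured random graph with colour law μ : 𝒳 → (0,1] and connection probabilities p_n satisfying a_n^{-1}·p_n(a,b) → C(a,b) for all a,b ∈ 𝒳, for some symmetric C : 𝒳×𝒳 → [0,∞) and a sequence (a_n) with a_n → 0 and n·a_n → ∞. Then the pair (L¹, L²) satisfies a large deviation principle in ℳ(𝒳)×ℳ̃_*(𝒳×𝒳) with speed a_n·n² and good rate function I₁(ω,ϖ) = (1/2)·𝔥_C(ϖ‖ω). -/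
open Filter
open scoped ENNReal

noncomputable section

namespace CRG

variable {𝒳 : Type} [Fintype 𝒳] [DecidableEq 𝒳]

/-- The set `ℰ` of formally ordered potential edges on `{1,…,n}`. -/
abbrev Edges (n : ℕ) : Finset (Fin n × Fin n) :=
  Finset.univ.filter (fun e : Fin n × Fin n => e.1 < e.2)

/-- The probability weight `P_n(x)` of a coloured graph `x` (colouring, edge set) under the
coloured random graph law with colour law `μ` and connection probabilities `p`. -/
def graphWeight (μ : 𝒳 → ℝ) (p : 𝒳 → 𝒳 → ℝ) (n : ℕ)
    (x : (Fin n → 𝒳) × Finset (Fin n × Fin n)) : ℝ :=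
  (if x.2 ⊆ Edges n then 1 else 0) *
  (∏ v, μ (x.1 v)) *
  ∏ e ∈ Edges n, (if e ∈ x.2 then p (x.1 e.1) (x.1 e.2) else 1 - p (x.1 e.1) (x.1 e.2))

/-- The probability `ℙ_n(S)` of an event `S` under the coloured random graph law. -/
def graphPr (μ : 𝒳 → ℝ) (p : 𝒳 → 𝒳 → ℝ) (n : ℕ)
    (S : Set ((Fin n → 𝒳) × Finset (Fin n × Fin n))) : ℝ :=
  ∑ x, S.indicator (graphWeight μ p n) x

/-- The empirical colour measure `L¹`. -/
def L1 (n : ℕ) (x : (Fin n → 𝒳) × Finset (Fin n × Fin n)) (a : 𝒳) : ℝ :=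
  ((Finset.univ.filter (fun v : Fin n => x.1 v = a)).card : ℝ) / n

/-- The empirical pair measure `L²` (scaled by `1/(n² aₙ)`). -/
def L2 (an : ℝ) (n : ℕ) (x : (Fin n → 𝒳) × Finset (Fin n × Fin n)) (q : 𝒳 × 𝒳) : ℝ :=
  (∑ e ∈ x.2, ((if (x.1 e.1, x.1 e.2) = q then (1:ℝ) else 0)
    + (if (x.1 e.2, x.1 e.1) = q then (1:ℝ) else 0))) / ((n:ℝ)^2 * an)

/-- Extended-real logarithm, `log 0 = -∞`. -/
def elog (x : ℝ) : EReal := if x ≤ 0 then ⊥ else ((Real.log x : ℝ) : EReal)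

/-- `ℳ(𝒳) × ℳ̃_*(𝒳×𝒳)`: probability vectors paired with finite symmetric measures,
viewed inside `ℝ^𝒳 × ℝ^(𝒳×𝒳)`. -/
def MSpace (𝒳 : Type) [Fintype 𝒳] : Set ((𝒳 → ℝ) × (𝒳 × 𝒳 → ℝ)) :=
  {z | (∀ a, 0 ≤ z.1 a) ∧ (∑ a, z.1 a) = 1 ∧ (∀ q, 0 ≤ z.2 q) ∧ ∀ a b, z.2 (a,b) = z.2 (b,a)}

open Classical in
/-- Relative entropy `H(ν‖ρ)` of measures on a finite set, `+∞` if `ν` is not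
absolutely continuous w.r.t. `ρ`. -/
def relEnt (ν ρ : 𝒳 → ℝ) : ℝ≥0∞ :=
  if ∀ x, ρ x = 0 → ν x = 0 then
    ENNReal.ofReal (∑ x, ν x * Real.log (ν x / ρ x)) else ⊤

open Classical in
/-- `𝔥_C(ϖ‖ω) = H(ϖ‖Cω⊗ω) + ‖Cω⊗ω‖ − ‖ϖ‖`. -/
def hRel (C : 𝒳 → 𝒳 → ℝ) (ω : 𝒳 → ℝ) (ϖ : 𝒳 × 𝒳 → ℝ) : ℝ≥0∞ :=
  if ∀ q : 𝒳 × 𝒳, C q.1 q.2 * ω q.1 * ω q.2 = 0 → ϖ q = 0 then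
    ENNReal.ofReal ((∑ q : 𝒳 × 𝒳, ϖ q * Real.log (ϖ q / (C q.1 q.2 * ω q.1 * ω q.2)))
      + (∑ q : 𝒳 × 𝒳, C q.1 q.2 * ω q.1 * ω q.2) - ∑ q : 𝒳 × 𝒳, ϖ q)
  else ⊤

end CRG

open CRG

/-- The rate function `I₁(ω,ϖ) = ½ 𝔥_C(ϖ‖ω)`. -/
def I1 {𝒳 : Type} [Fintype 𝒳] (C : 𝒳 → 𝒳 → ℝ) (z : (𝒳 → ℝ) × (𝒳 × 𝒳 → ℝ)) : ℝ≥0∞ :=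
  (1/2 : ℝ≥0∞) * hRel C z.1 z.2

namespace CRG

section Tilt

variable {𝒳 : Type}

open Classical in
/-- The tilt `log (ϖ/ρ + δ)` with `ρ = Cω⊗ω`, set to `0` where `ρ` vanishes. -/
def tiltFn (C : 𝒳 → 𝒳 → ℝ) (z : (𝒳 → ℝ) × (𝒳 × 𝒳 → ℝ)) (δ : ℝ) (q : 𝒳 × 𝒳) : ℝ :=
  if C q.1 q.2 * z.1 q.1 * z.1 q.2 = 0 then 0
  else Real.log (z.2 q / (C q.1 q.2 * z.1 q.1 * z.1 q.2) + δ)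

lemma tendsto_mul_tiltFn {C : 𝒳 → 𝒳 → ℝ}
    {z : (𝒳 → ℝ) × (𝒳 × 𝒳 → ℝ)}
    (hac : ∀ q : 𝒳 × 𝒳, C q.1 q.2 * z.1 q.1 * z.1 q.2 = 0 → z.2 q = 0) (q : 𝒳 × 𝒳) :
    Tendsto (fun δ => tiltFn C z δ q * z.2 q) (nhdsWithin 0 (Set.Ioi 0))
      (nhds (z.2 q * Real.log (z.2 q / (C q.1 q.2 * z.1 q.1 * z.1 q.2)))) := by
  by_cases hx : z.2 q = 0
  · simp [hx]
  have h : C q.1 q.2 * z.1 q.1 * z.1 q.2 ≠ 0 := fun h => hx (hac q h)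
  simp only [tiltFn, if_neg h]
  rw [mul_comm (z.2 q)]
  refine (Tendsto.mul_const _ ?_)
  refine Tendsto.log ?_ (div_ne_zero hx h)
  refine tendsto_nhdsWithin_of_tendsto_nhds ?_
  exact Continuous.tendsto' (by fun_prop) _ _ (by simp)

lemma tendsto_mul_tiltFn_add {C : 𝒳 → 𝒳 → ℝ}
    {z : (𝒳 → ℝ) × (𝒳 × 𝒳 → ℝ)}
    (hac : ∀ q : 𝒳 × 𝒳, C q.1 q.2 * z.1 q.1 * z.1 q.2 = 0 → z.2 q = 0) (q : 𝒳 × 𝒳) :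
    Tendsto (fun δ => tiltFn C z δ q * (z.2 q + δ * (C q.1 q.2 * z.1 q.1 * z.1 q.2)))
      (nhdsWithin 0 (Set.Ioi 0))
      (nhds (z.2 q * Real.log (z.2 q / (C q.1 q.2 * z.1 q.1 * z.1 q.2)))) := by
  by_cases h : C q.1 q.2 * z.1 q.1 * z.1 q.2 = 0
  · simp [h, hac q h]
  simp only [tiltFn, if_neg h]
  set r := C q.1 q.2 * z.1 q.1 * z.1 q.2
  refine tendsto_nhdsWithin_of_tendsto_nhds ?_
  have hc : Continuous fun δ : ℝ => r * ((z.2 q / r + δ) * Real.log (z.2 q / r + δ)) :=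
    continuous_const.mul (Real.continuous_mul_log.comp (by fun_prop))
  have := hc.tendsto' 0 (z.2 q * Real.log (z.2 q / r)) (by simp; field_simp)
  refine this.congr fun δ => ?_
  field_simp

end Tilt

section RateFunction

variable {𝒳 : Type} [Fintype 𝒳]

/-- The affine functional `½ (⟨g, ϖ⟩ - ⟨Cω⊗ω, e^g - 1⟩)`, whose supremum over symmetric `g` is the
rate function `I1`. -/
def dualFn (C : 𝒳 → 𝒳 → ℝ) (g : 𝒳 × 𝒳 → ℝ) (z : (𝒳 → ℝ) × (𝒳 × 𝒳 → ℝ)) : ℝ :=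
  (1/2) * ∑ q : 𝒳 × 𝒳, (g q * z.2 q - C q.1 q.2 * z.1 q.1 * z.1 q.2 * (Real.exp (g q) - 1))

lemma continuous_dualFn (C : 𝒳 → 𝒳 → ℝ) (g : 𝒳 × 𝒳 → ℝ) : Continuous (dualFn C g) := by
  unfold dualFn
  fun_prop

lemma young_entropy {x r : ℝ} (hx : 0 ≤ x) (hr : 0 ≤ r) (h : r = 0 → x = 0) (g : ℝ) :
    g * x - r * (Real.exp g - 1) ≤ x * Real.log (x / r) + r - x := by
  rcases hr.eq_or_lt with hr | hr
  · simp [h hr.symm, ← hr]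
  rcases hx.eq_or_lt with hx | hx
  · subst hx
    have := Real.exp_pos g
    simp only [mul_zero, zero_mul]
    nlinarith
  have hlog : Real.exp (Real.log (x / r)) = x / r := Real.exp_log (by positivity)
  have h1 := Real.add_one_le_exp (g - Real.log (x / r))
  rw [Real.exp_sub, hlog] at h1
  have h2 : x * (g - Real.log (x / r) + 1) ≤ x * (Real.exp g / (x / r)) :=
    mul_le_mul_of_nonneg_left h1 hx.le
  have h3 : x * (Real.exp g / (x / r)) = r * Real.exp g := by field_simp
  nlinarith

lemma I1_eq_coe {C : 𝒳 → 𝒳 → ℝ} (hC0 : ∀ a b, 0 ≤ C a b) {z : (𝒳 → ℝ) × (𝒳 × 𝒳 → ℝ)}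
    (hz : z ∈ MSpace 𝒳) (hac : ∀ q : 𝒳 × 𝒳, C q.1 q.2 * z.1 q.1 * z.1 q.2 = 0 → z.2 q = 0) :
    (I1 C z : EReal) = (((1/2) * ∑ q : 𝒳 × 𝒳,
      (z.2 q * Real.log (z.2 q / (C q.1 q.2 * z.1 q.1 * z.1 q.2))
        + C q.1 q.2 * z.1 q.1 * z.1 q.2 - z.2 q) : ℝ) : EReal) := by
  have hS : 0 ≤ ∑ q : 𝒳 × 𝒳, (z.2 q * Real.log (z.2 q / (C q.1 q.2 * z.1 q.1 * z.1 q.2))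
        + C q.1 q.2 * z.1 q.1 * z.1 q.2 - z.2 q) := by
    refine Finset.sum_nonneg fun q _ => ?_
    have := young_entropy (hz.2.2.1 q)
      (mul_nonneg (mul_nonneg (hC0 q.1 q.2) (hz.1 _)) (hz.1 _)) (hac q) 0
    simpa using this
  have h2 : (1/2 : ℝ≥0∞) = ENNReal.ofReal (1/2) := by
    rw [ENNReal.ofReal_div_of_pos two_pos]; simp
  rw [I1, hRel, if_pos hac, ← Finset.sum_add_distrib, ← Finset.sum_sub_distrib, h2,
    ← ENNReal.ofReal_mul (by norm_num), EReal.coe_ennreal_ofReal, max_eq_left (by positivity)]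

lemma I1_eq_top {C : 𝒳 → 𝒳 → ℝ} {z : (𝒳 → ℝ) × (𝒳 × 𝒳 → ℝ)}
    (hac : ¬ ∀ q : 𝒳 × 𝒳, C q.1 q.2 * z.1 q.1 * z.1 q.2 = 0 → z.2 q = 0) : I1 C z = ⊤ := by
  rw [I1, hRel, if_neg hac]
  exact ENNReal.mul_top (by simp)

lemma dualFn_le_I1 {C : 𝒳 → 𝒳 → ℝ} (hC0 : ∀ a b, 0 ≤ C a b) (g : 𝒳 × 𝒳 → ℝ)
    {z : (𝒳 → ℝ) × (𝒳 × 𝒳 → ℝ)} (hz : z ∈ MSpace 𝒳) :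
    (dualFn C g z : EReal) ≤ (I1 C z : EReal) := by
  by_cases hac : ∀ q : 𝒳 × 𝒳, C q.1 q.2 * z.1 q.1 * z.1 q.2 = 0 → z.2 q = 0
  · rw [I1_eq_coe hC0 hz hac, EReal.coe_le_coe_iff]
    refine mul_le_mul_of_nonneg_left (Finset.sum_le_sum fun q _ => ?_) (by norm_num)
    exact young_entropy (hz.2.2.1 q)
      (mul_nonneg (mul_nonneg (hC0 q.1 q.2) (hz.1 _)) (hz.1 _)) (hac q) (g q)
  · simp [I1_eq_top hac]

lemma tiltFn_symm {C : 𝒳 → 𝒳 → ℝ} (hC : ∀ a b, C a b = C b a)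
    {z : (𝒳 → ℝ) × (𝒳 × 𝒳 → ℝ)} (hz : z ∈ MSpace 𝒳) (δ : ℝ) (a b : 𝒳) :
    tiltFn C z δ (a, b) = tiltFn C z δ (b, a) := by
  simp only [tiltFn, hz.2.2.2 a b, hC a b, mul_right_comm (C b a) (z.1 a)]

lemma mul_exp_tiltFn {C : 𝒳 → 𝒳 → ℝ} (hC0 : ∀ a b, 0 ≤ C a b)
    {z : (𝒳 → ℝ) × (𝒳 × 𝒳 → ℝ)} (hz : z ∈ MSpace 𝒳)
    (hac : ∀ q : 𝒳 × 𝒳, C q.1 q.2 * z.1 q.1 * z.1 q.2 = 0 → z.2 q = 0) {δ : ℝ} (hδ : 0 < δ)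
    (q : 𝒳 × 𝒳) :
    C q.1 q.2 * z.1 q.1 * z.1 q.2 * Real.exp (tiltFn C z δ q)
      = z.2 q + δ * (C q.1 q.2 * z.1 q.1 * z.1 q.2) := by
  by_cases h : C q.1 q.2 * z.1 q.1 * z.1 q.2 = 0
  · simp [h, hac q h]
  · have hr : 0 < C q.1 q.2 * z.1 q.1 * z.1 q.2 :=
      lt_of_le_of_ne (mul_nonneg (mul_nonneg (hC0 q.1 q.2) (hz.1 _)) (hz.1 _)) (Ne.symm h)
    have hx := hz.2.2.1 q
    rw [tiltFn, if_neg h, Real.exp_log (by positivity), mul_add, mul_div_cancel₀ _ h]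
    ring

lemma tendsto_dualFn_tiltFn {C : 𝒳 → 𝒳 → ℝ} (hC0 : ∀ a b, 0 ≤ C a b)
    {z : (𝒳 → ℝ) × (𝒳 × 𝒳 → ℝ)} (hz : z ∈ MSpace 𝒳)
    (hac : ∀ q : 𝒳 × 𝒳, C q.1 q.2 * z.1 q.1 * z.1 q.2 = 0 → z.2 q = 0)
    (y : ℝ → 𝒳 × 𝒳 → ℝ)
    (hy : ∀ q, Tendsto (fun δ => tiltFn C z δ q * y δ q) (nhdsWithin 0 (Set.Ioi 0))
      (nhds (z.2 q * Real.log (z.2 q / (C q.1 q.2 * z.1 q.1 * z.1 q.2))))) :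
    Tendsto (fun δ => dualFn C (tiltFn C z δ) (z.1, y δ)) (nhdsWithin 0 (Set.Ioi 0))
      (nhds ((1/2) * ∑ q : 𝒳 × 𝒳, (z.2 q * Real.log (z.2 q / (C q.1 q.2 * z.1 q.1 * z.1 q.2))
        + C q.1 q.2 * z.1 q.1 * z.1 q.2 - z.2 q))) := by
  refine Tendsto.const_mul _ (tendsto_finsetSum _ fun q _ => ?_)
  have hlin : Tendsto (fun δ : ℝ => z.2 q + δ * (C q.1 q.2 * z.1 q.1 * z.1 q.2)
      - C q.1 q.2 * z.1 q.1 * z.1 q.2) (nhdsWithin 0 (Set.Ioi 0))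
      (nhds (z.2 q - C q.1 q.2 * z.1 q.1 * z.1 q.2)) :=
    tendsto_nhdsWithin_of_tendsto_nhds (Continuous.tendsto' (by fun_prop) _ _ (by simp))
  have h := (hy q).sub hlin
  rw [show z.2 q * Real.log (z.2 q / (C q.1 q.2 * z.1 q.1 * z.1 q.2))
    + C q.1 q.2 * z.1 q.1 * z.1 q.2 - z.2 q = z.2 q * Real.log
    (z.2 q / (C q.1 q.2 * z.1 q.1 * z.1 q.2)) - (z.2 q - C q.1 q.2 * z.1 q.1 * z.1 q.2) by ring]
  refine h.congr' ?_
  filter_upwards [self_mem_nhdsWithin] with δ hδ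
  rw [← mul_exp_tiltFn hC0 hz hac hδ q]
  ring

lemma exists_lt_dualFn {C : 𝒳 → 𝒳 → ℝ} (hC0 : ∀ a b, 0 ≤ C a b) (hC : ∀ a b, C a b = C b a)
    {z : (𝒳 → ℝ) × (𝒳 × 𝒳 → ℝ)} (hz : z ∈ MSpace 𝒳) {c : ℝ} (hc : (c : EReal) < I1 C z) :
    ∃ g : 𝒳 × 𝒳 → ℝ, (∀ a b, g (a, b) = g (b, a)) ∧ c < dualFn C g z := by
  by_cases hac : ∀ q : 𝒳 × 𝒳, C q.1 q.2 * z.1 q.1 * z.1 q.2 = 0 → z.2 q = 0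
  · rw [I1_eq_coe hC0 hz hac, EReal.coe_lt_coe_iff] at hc
    have h := tendsto_dualFn_tiltFn hC0 hz hac (fun _ => z.2) (tendsto_mul_tiltFn hac)
    obtain ⟨δ, hδ⟩ := (h.eventually (lt_mem_nhds hc)).exists
    exact ⟨tiltFn C z δ, tiltFn_symm hC hz δ, hδ⟩
  · classical
    push Not at hac
    obtain ⟨q₀, hq₀, hx₀⟩ := hac
    set s := ∑ q : 𝒳 × 𝒳, if C q.1 q.2 * z.1 q.1 * z.1 q.2 = 0 then z.2 q else 0 with hs
    have hs0 : 0 < s := by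
      refine Finset.sum_pos' (fun q _ => ?_) ⟨q₀, Finset.mem_univ _, ?_⟩
      · split_ifs
        exacts [hz.2.2.1 q, le_rfl]
      · rw [if_pos hq₀]
        exact lt_of_le_of_ne (hz.2.2.1 q₀) (Ne.symm hx₀)
    set t := (2 * |c| + 2) / s
    refine ⟨fun q => if C q.1 q.2 * z.1 q.1 * z.1 q.2 = 0 then t else 0, fun a b => ?_, ?_⟩
    · simp only [hC a b, mul_right_comm (C b a) (z.1 a)]
    · have h : ∀ q : 𝒳 × 𝒳, (if C q.1 q.2 * z.1 q.1 * z.1 q.2 = 0 then t else 0) * z.2 q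
          - C q.1 q.2 * z.1 q.1 * z.1 q.2 *
            (Real.exp (if C q.1 q.2 * z.1 q.1 * z.1 q.2 = 0 then t else 0) - 1)
          = t * (if C q.1 q.2 * z.1 q.1 * z.1 q.2 = 0 then z.2 q else 0) := by
        intro q
        split_ifs with h
        · simp [h]
        · simp
      rw [dualFn, Finset.sum_congr rfl fun q _ => h q, ← Finset.mul_sum, ← hs,
        div_mul_cancel₀ _ hs0.ne']
      have := le_abs_self c
      linarith

lemma isClosed_MSpace : IsClosed (MSpace 𝒳) := by
  simp only [MSpace, Set.ofPred_and, Set.ofPred_forall]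
  refine IsClosed.inter ?_ (IsClosed.inter ?_ (IsClosed.inter ?_ ?_))
  · exact isClosed_iInter fun a => isClosed_le (by fun_prop) (by fun_prop)
  · exact isClosed_eq (by fun_prop) (by fun_prop)
  · exact isClosed_iInter fun a => isClosed_le (by fun_prop) (by fun_prop)
  · exact isClosed_iInter fun a => isClosed_iInter fun b => isClosed_eq (by fun_prop) (by fun_prop)

lemma isCompact_dualFn_one_le (C : 𝒳 → 𝒳 → ℝ) (hC0 : ∀ a b, 0 ≤ C a b) (c : ℝ) :
    IsCompact {z | z ∈ MSpace 𝒳 ∧ dualFn C (fun _ => 1) z ≤ c} := by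
  set M := 2 * c + (Real.exp 1 - 1) * ∑ q : 𝒳 × 𝒳, C q.1 q.2
  have hK : IsCompact ((Set.Icc (fun _ => 0) (fun _ => 1) : Set (𝒳 → ℝ)) ×ˢ
      (Set.Icc (fun _ => 0) (fun _ => M) : Set (𝒳 × 𝒳 → ℝ))) := isCompact_Icc.prod isCompact_Icc
  refine hK.of_isClosed_subset (isClosed_MSpace.inter
    (isClosed_le (continuous_dualFn C _) continuous_const)) ?_
  rintro z ⟨hz, hzc⟩
  have h1 : ∀ a, z.1 a ≤ 1 := fun a =>
    hz.2.1 ▸ Finset.single_le_sum (fun b _ => hz.1 b) (Finset.mem_univ a)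
  have he : (0 : ℝ) ≤ Real.exp 1 - 1 := by
    have := Real.add_one_le_exp (1 : ℝ)
    linarith
  have hsum : ∑ q, z.2 q ≤ M := by
    have hle : ∑ q : 𝒳 × 𝒳, C q.1 q.2 * z.1 q.1 * z.1 q.2 ≤ ∑ q : 𝒳 × 𝒳, C q.1 q.2 := by
      refine Finset.sum_le_sum fun q _ => ?_
      rw [mul_assoc]
      exact mul_le_of_le_one_right (hC0 _ _) (mul_le_one₀ (h1 _) (hz.1 _) (h1 _))
    have hle' := mul_le_mul_of_nonneg_left hle he
    simp only [dualFn, one_mul, Finset.sum_sub_distrib, ← Finset.sum_mul] at hzc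
    simp only [M]
    linarith
  refine ⟨⟨fun a => hz.1 a, fun a => h1 a⟩, ⟨fun q => hz.2.2.1 q, fun q => ?_⟩⟩
  exact (Finset.single_le_sum (fun b _ => hz.2.2.1 b) (Finset.mem_univ q)).trans hsum

lemma lowerSemicontinuousOn_I1 {C : 𝒳 → 𝒳 → ℝ} (hC0 : ∀ a b, 0 ≤ C a b)
    (hC : ∀ a b, C a b = C b a) : LowerSemicontinuousOn (I1 C) (MSpace 𝒳) := by
  intro z hz y hy
  obtain ⟨c, hyc, hcz⟩ := EReal.lt_iff_exists_real_btwn.1 (EReal.coe_ennreal_lt_coe_ennreal_iff.2 hy)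
  obtain ⟨g, -, hg⟩ := exists_lt_dualFn hC0 hC hz hcz
  have := (continuous_dualFn C g).continuousAt.eventually (lt_mem_nhds hg)
  filter_upwards [mem_nhdsWithin_of_mem_nhds this, self_mem_nhdsWithin] with w hw hwM
  rw [gt_iff_lt, ← EReal.coe_ennreal_lt_coe_ennreal_iff]
  exact hyc.trans ((EReal.coe_lt_coe_iff.2 hw).trans_le (dualFn_le_I1 hC0 g hwM))

lemma isCompact_I1_le {C : 𝒳 → 𝒳 → ℝ} (hC0 : ∀ a b, 0 ≤ C a b)
    (hC : ∀ a b, C a b = C b a) (c : ℝ) :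
    IsCompact {z | z ∈ MSpace 𝒳 ∧ I1 C z ≤ ENNReal.ofReal c} := by
  refine (isCompact_dualFn_one_le C hC0 (max c 0)).of_isClosed_subset ?_ ?_
  · obtain ⟨v, hv, hv'⟩ := lowerSemicontinuousOn_iff_preimage_Iic.1
      (lowerSemicontinuousOn_I1 hC0 hC) (ENNReal.ofReal c)
    have : {z | z ∈ MSpace 𝒳 ∧ I1 C z ≤ ENNReal.ofReal c} = MSpace 𝒳 ∩ v := hv'
    exact this ▸ isClosed_MSpace.inter hv
  · rintro z ⟨hz, hzc⟩
    refine ⟨hz, ?_⟩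
    rw [← EReal.coe_le_coe_iff, ← EReal.coe_ennreal_ofReal]
    exact (dualFn_le_I1 hC0 _ hz).trans (EReal.coe_ennreal_le_coe_ennreal_iff.2 hzc)

end RateFunction

section Bernoulli

variable {ι : Type} [DecidableEq ι]

/-- The probability that a random subset of `s`, containing each `e ∈ s` independently with
probability `p e`, equals `E`. -/
def bernW (s : Finset ι) (p : ι → ℝ) (E : Finset ι) : ℝ :=
  ∏ e ∈ s, if e ∈ E then p e else 1 - p e

lemma bernW_nonneg {s : Finset ι} {p : ι → ℝ} (h0 : ∀ e, 0 ≤ p e) (h1 : ∀ e, p e ≤ 1)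
    (E : Finset ι) : 0 ≤ bernW s p E :=
  Finset.prod_nonneg fun e _ => by
    split_ifs
    exacts [h0 e, sub_nonneg.2 (h1 e)]

lemma bernW_mul_prod {s E : Finset ι} (hE : E ⊆ s) (p x : ι → ℝ) :
    bernW s p E * ∏ e ∈ E, x e = ∏ e ∈ s, if e ∈ E then p e * x e else 1 - p e := by
  rw [bernW, ← Finset.inter_eq_right.2 hE, ← Finset.prod_ite_mem, ← Finset.prod_mul_distrib]
  refine Finset.prod_congr rfl fun e he => ?_
  simp only [Finset.inter_eq_right.2 hE]
  split_ifs <;> simp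

lemma sum_bernW_mul_prod (s : Finset ι) (p x : ι → ℝ) :
    ∑ E ∈ s.powerset, bernW s p E * ∏ e ∈ E, x e = ∏ e ∈ s, (1 - p e + p e * x e) := by
  simp_rw [add_comm (1 - p _)]
  rw [Finset.prod_add]
  refine Finset.sum_congr rfl fun E hE => ?_
  rw [Finset.mem_powerset] at hE
  rw [bernW_mul_prod hE, Finset.prod_ite, Finset.filter_mem_eq_inter,
    Finset.inter_eq_right.2 hE, Finset.filter_notMem_eq_sdiff]

lemma sum_bernW (s : Finset ι) (p : ι → ℝ) : ∑ E ∈ s.powerset, bernW s p E = 1 := by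
  simpa using sum_bernW_mul_prod s p 1

lemma bernW_mul_prod_eq_tilt {s E : Finset ι} (hE : E ⊆ s) (p x : ι → ℝ)
    (h : ∀ e, 1 - p e + p e * x e ≠ 0) :
    bernW s p E * ∏ e ∈ E, x e = (∏ e ∈ s, (1 - p e + p e * x e)) *
      bernW s (fun e => p e * x e / (1 - p e + p e * x e)) E := by
  rw [bernW_mul_prod hE, bernW, ← Finset.prod_mul_distrib]
  refine Finset.prod_congr rfl fun e _ => ?_
  have := h e
  split_ifs
  · field_simp
  · field_simp
    ring

lemma sum_bernW_mul_exp_le {s : Finset ι} {p : ι → ℝ} (h0 : ∀ e, 0 ≤ p e) (h1 : ∀ e, p e ≤ 1)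
    (c : ι → ℝ) :
    ∑ E ∈ s.powerset, bernW s p E * Real.exp (∑ e ∈ E, c e)
      ≤ Real.exp (∑ e ∈ s, p e * (Real.exp (c e) - 1)) := by
  simp_rw [Real.exp_sum]
  rw [sum_bernW_mul_prod]
  refine Finset.prod_le_prod (fun e _ => ?_) fun e _ => ?_
  · have := mul_nonneg (h0 e) (Real.exp_pos (c e)).le
    linarith [h1 e]
  · have := Real.add_one_le_exp (p e * (Real.exp (c e) - 1))
    linarith

open Classical in
lemma bernW_upper_tail {s : Finset ι} {p : ι → ℝ} (h0 : ∀ e, 0 ≤ p e) (h1 : ∀ e, p e ≤ 1)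
    (c : ι → ℝ) {B : ℝ} (hc : ∀ e, |c e| ≤ B) (hB : B ≤ 1) (u : ℝ) :
    ∑ E ∈ s.powerset with u ≤ ∑ e ∈ E, c e - ∑ e ∈ s, p e * c e, bernW s p E
      ≤ Real.exp (B ^ 2 * ∑ e ∈ s, p e - u) := by
  have hmgf := sum_bernW_mul_exp_le (s := s) h0 h1 c
  have hexp : ∑ e ∈ s, p e * (Real.exp (c e) - 1)
      ≤ ∑ e ∈ s, p e * c e + B ^ 2 * ∑ e ∈ s, p e := by
    rw [Finset.mul_sum, ← Finset.sum_add_distrib]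
    refine Finset.sum_le_sum fun e _ => ?_
    have h2 := (abs_le.1 (Real.abs_exp_sub_one_sub_id_le ((hc e).trans hB))).2
    have h3 : c e ^ 2 ≤ B ^ 2 := sq_le_sq' (abs_le.1 (hc e)).1 (abs_le.1 (hc e)).2
    nlinarith [h0 e]
  calc _ ≤ ∑ E ∈ s.powerset, bernW s p E * Real.exp (∑ e ∈ E, c e)
          * Real.exp (- (∑ e ∈ s, p e * c e + u)) := by
        rw [Finset.sum_filter]
        refine Finset.sum_le_sum fun E _ => ?_
        have hw := bernW_nonneg (s := s) h0 h1 E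
        split_ifs with h
        · rw [mul_assoc, ← Real.exp_add]
          exact le_mul_of_one_le_right hw (Real.one_le_exp (by linarith))
        · positivity
    _ ≤ Real.exp (∑ e ∈ s, p e * c e + B ^ 2 * ∑ e ∈ s, p e)
          * Real.exp (- (∑ e ∈ s, p e * c e + u)) := by
        rw [← Finset.sum_mul]
        gcongr
        exact hmgf.trans (Real.exp_le_exp.2 hexp)
    _ = _ := by
        rw [← Real.exp_add]
        congr 1
        ring

open Classical in
lemma bernW_two_sided_tail {s : Finset ι} {p : ι → ℝ} (h0 : ∀ e, 0 ≤ p e) (h1 : ∀ e, p e ≤ 1)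
    (c : ι → ℝ) (hc : ∀ e, |c e| ≤ 2) {t : ℝ} (ht0 : 0 < t) (ht : 2 * t ≤ 1) (u : ℝ) :
    ∑ E ∈ s.powerset with u ≤ |∑ e ∈ E, c e - ∑ e ∈ s, p e * c e|, bernW s p E
      ≤ 2 * Real.exp ((2 * t) ^ 2 * ∑ e ∈ s, p e - t * u) := by
  have hb : ∀ σ : ℝ, |σ| = 1 → ∀ e, |σ * t * c e| ≤ 2 * t := fun σ hσ e => by
    rw [abs_mul, abs_mul, hσ, abs_of_pos ht0]
    nlinarith [hc e]
  have hu := bernW_upper_tail (s := s) h0 h1 _ (hb 1 (by simp)) ht (t * u)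
  have hl := bernW_upper_tail (s := s) h0 h1 _ (hb (-1) (by simp)) ht (t * u)
  rw [two_mul]
  refine le_trans ?_ (add_le_add hu hl)
  simp only [Finset.sum_filter, ← Finset.sum_add_distrib]
  refine Finset.sum_le_sum fun E _ => ?_
  have hw := bernW_nonneg (s := s) h0 h1 E
  have key : ∀ σ : ℝ, ∑ e ∈ E, σ * t * c e - ∑ e ∈ s, p e * (σ * t * c e)
      = t * (σ * (∑ e ∈ E, c e - ∑ e ∈ s, p e * c e)) := fun σ => by
    simp only [mul_sub, Finset.mul_sum]
    congr 1 <;> exact Finset.sum_congr rfl fun _ _ => by ring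
  simp only [key, mul_le_mul_iff_right₀ ht0]
  simp only [one_mul, neg_one_mul, le_abs]
  split_ifs <;> first | tauto | linarith

end Bernoulli

section GraphWeight

variable {𝒳 : Type}

lemma L1_nonneg [DecidableEq 𝒳] {n : ℕ} (x : (Fin n → 𝒳) × Finset (Fin n × Fin n)) (i : 𝒳) :
    0 ≤ L1 n x i := by
  unfold L1
  positivity

lemma graphWeight_nonneg {μ : 𝒳 → ℝ} (hμ : ∀ i, 0 < μ i) {p : 𝒳 → 𝒳 → ℝ}
    (hp0 : ∀ i j, 0 ≤ p i j) (hp1 : ∀ i j, p i j ≤ 1) (n : ℕ)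
    (x : (Fin n → 𝒳) × Finset (Fin n × Fin n)) : 0 ≤ graphWeight μ p n x := by
  refine mul_nonneg (mul_nonneg (by split_ifs <;> norm_num)
    (Finset.prod_nonneg fun v _ => (hμ _).le)) ?_
  exact bernW_nonneg (p := fun e => p (x.1 e.1) (x.1 e.2)) (fun e => hp0 _ _) (fun e => hp1 _ _) x.2

lemma sum_graphWeight_mul [Fintype 𝒳] (μ : 𝒳 → ℝ) (p : 𝒳 → 𝒳 → ℝ)
    (n : ℕ)    (f : (Fin n → 𝒳) × Finset (Fin n × Fin n) → ℝ) :
    ∑ x, graphWeight μ p n x * f x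
      = ∑ σ : Fin n → 𝒳, (∏ v, μ (σ v)) * ∑ E ∈ (Edges n).powerset,
          bernW (Edges n) (fun e => p (σ e.1) (σ e.2)) E * f (σ, E) := by
  rw [Fintype.sum_prod_type]
  refine Finset.sum_congr rfl fun σ _ => ?_
  rw [← Finset.sum_subset (Finset.subset_univ (Edges n).powerset), Finset.mul_sum]
  · refine Finset.sum_congr rfl fun E hE => ?_
    rw [graphWeight, if_pos (Finset.mem_powerset.1 hE), bernW]
    ring
  · intro E _ hE
    rw [graphWeight, if_neg (fun h => hE (Finset.mem_powerset.2 h))]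
    ring

lemma graphPr_eq_sum [Fintype 𝒳] (μ : 𝒳 → ℝ) (p : 𝒳 → 𝒳 → ℝ) (n : ℕ)
    (S : Set ((Fin n → 𝒳) × Finset (Fin n × Fin n))) :
    graphPr μ p n S = ∑ x, graphWeight μ p n x * S.indicator 1 x := by
  refine Finset.sum_congr rfl fun x _ => ?_
  by_cases h : x ∈ S <;> simp [h]

end GraphWeight

section Graph

variable {𝒳 : Type} [Fintype 𝒳] [DecidableEq 𝒳]

lemma sum_comp_colour {n : ℕ} (hn : 0 < n) (x : (Fin n → 𝒳) × Finset (Fin n × Fin n))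
    (f : 𝒳 → ℝ) : ∑ v, f (x.1 v) = n * ∑ i, L1 n x i * f i := by
  have hn' : (n : ℝ) ≠ 0 := by positivity
  rw [← Finset.sum_fiberwise Finset.univ x.1, Finset.mul_sum]
  refine Finset.sum_congr rfl fun i _ => ?_
  rw [Finset.sum_congr rfl fun v hv => congrArg f (Finset.mem_filter.1 hv).2, Finset.sum_const,
    nsmul_eq_mul, L1]
  field_simp

lemma sum_L1 {n : ℕ} (hn : 0 < n) (x : (Fin n → 𝒳) × Finset (Fin n × Fin n)) :
    ∑ i, L1 n x i = 1 := by
  have hn' : (n : ℝ) ≠ 0 := by positivity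
  have h := sum_comp_colour hn x 1
  simp only [Pi.one_apply, Finset.sum_const, Finset.card_univ, Fintype.card_fin, nsmul_eq_mul,
    mul_one] at h
  exact (mul_left_cancel₀ hn' (h.symm.trans (mul_one _).symm))

lemma L1_le_one {n : ℕ} (hn : 0 < n) (x : (Fin n → 𝒳) × Finset (Fin n × Fin n)) (i : 𝒳) :
    L1 n x i ≤ 1 :=
  sum_L1 hn x ▸ Finset.single_le_sum (fun j _ => L1_nonneg x j) (Finset.mem_univ i)

lemma sum_edges_colour {n : ℕ} (hn : 0 < n) (x : (Fin n → 𝒳) × Finset (Fin n × Fin n))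
    {F : 𝒳 → 𝒳 → ℝ} (hF : ∀ i j, F i j = F j i) :
    ∑ e ∈ Edges n, F (x.1 e.1) (x.1 e.2)
      = (n : ℝ) ^ 2 * ((1/2) * ∑ q : 𝒳 × 𝒳, F q.1 q.2 * L1 n x q.1 * L1 n x q.2)
        - n * ((1/2) * ∑ i, L1 n x i * F i i) := by
  have hall : ∑ e : Fin n × Fin n, F (x.1 e.1) (x.1 e.2)
      = (n : ℝ) ^ 2 * ∑ q : 𝒳 × 𝒳, F q.1 q.2 * L1 n x q.1 * L1 n x q.2 := by
    simp only [Fintype.sum_prod_type]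
    simp_rw [sum_comp_colour hn x (F _)]
    rw [sum_comp_colour hn x (fun i => (n : ℝ) * ∑ j, L1 n x j * F i j)]
    simp only [Finset.mul_sum]
    exact Finset.sum_congr rfl fun i _ => Finset.sum_congr rfl fun j _ => by ring
  have hdiag := sum_comp_colour hn x (fun i => F i i)
  have hsplit : ∑ e : Fin n × Fin n, F (x.1 e.1) (x.1 e.2)
      = ∑ e ∈ Edges n, F (x.1 e.1) (x.1 e.2) + ∑ e ∈ Edges n, F (x.1 e.1) (x.1 e.2)
        + ∑ v, F (x.1 v) (x.1 v) := by
    have hswap : ∑ e ∈ Edges n, F (x.1 e.1) (x.1 e.2)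
        = ∑ e : Fin n × Fin n, if e.2 < e.1 then F (x.1 e.1) (x.1 e.2) else 0 := by
      rw [Finset.sum_filter, ← (Equiv.prodComm (Fin n) (Fin n)).sum_comp]
      exact Finset.sum_congr rfl fun e _ => by simp [hF (x.1 e.2)]
    have hd : ∑ v, F (x.1 v) (x.1 v)
        = ∑ e : Fin n × Fin n, if e.1 = e.2 then F (x.1 e.1) (x.1 e.2) else 0 := by
      simp [Fintype.sum_prod_type]
    nth_rewrite 2 [hswap]
    rw [hd, Finset.sum_filter, ← Finset.sum_add_distrib, ← Finset.sum_add_distrib]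
    refine Finset.sum_congr rfl fun e _ => ?_
    rcases lt_trichotomy e.1 e.2 with h | h | h
    · simp [h, h.ne, h.not_gt]
    · simp [h]
    · simp [h, h.ne', h.not_gt]
  linarith

/-- Sums over the edge slots of a function of the end colours of order `a n` are determined by the
empirical colour measure up to `o(n² a n)`, uniformly in the colouring. -/
lemma exists_sum_edges_approx {a : ℕ → ℝ} (hapos : ∀ n, 0 < a n) {F : ℕ → 𝒳 → 𝒳 → ℝ}
    (hsymm : ∀ n i j, F n i j = F n j i) {G : 𝒳 → 𝒳 → ℝ}
    (hF : ∀ i j, Tendsto (fun n => F n i j / a n) atTop (nhds (G i j))) :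
    ∃ ε : ℕ → ℝ, Tendsto ε atTop (nhds 0) ∧
      ∀ n, 0 < n → ∀ x : (Fin n → 𝒳) × Finset (Fin n × Fin n),
        |∑ e ∈ Edges n, F n (x.1 e.1) (x.1 e.2) - (n : ℝ) ^ 2 * a n *
          ((1/2) * ∑ q : 𝒳 × 𝒳, G q.1 q.2 * L1 n x q.1 * L1 n x q.2)|
        ≤ (n : ℝ) ^ 2 * a n * ε n := by
  refine ⟨fun n => (1/2) * (∑ q : 𝒳 × 𝒳, |F n q.1 q.2 / a n - G q.1 q.2|
    + (n : ℝ)⁻¹ * ∑ i, |F n i i / a n|), ?_, fun n hn x => ?_⟩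
  · have h1 : Tendsto (fun n => ∑ q : 𝒳 × 𝒳, |F n q.1 q.2 / a n - G q.1 q.2|) atTop
        (nhds (∑ q : 𝒳 × 𝒳, |G q.1 q.2 - G q.1 q.2|)) :=
      tendsto_finsetSum _ fun q _ => ((hF q.1 q.2).sub_const _).abs
    have h2 : Tendsto (fun n => ∑ i, |F n i i / a n|) atTop (nhds (∑ i, |G i i|)) :=
      tendsto_finsetSum _ fun i _ => (hF i i).abs
    have h3 := (h1.add (tendsto_inv_atTop_nhds_zero_nat (𝕜 := ℝ) |>.mul h2)).const_mul (1/2)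
    simpa using h3
  · have hn' : (0 : ℝ) < n := by positivity
    have ha := hapos n
    have hω := L1_nonneg x
    have hω1 := L1_le_one hn x
    rw [sum_edges_colour hn x (hsymm n)]
    have e1 : (n : ℝ) ^ 2 * ((1/2) * ∑ q : 𝒳 × 𝒳, F n q.1 q.2 * L1 n x q.1 * L1 n x q.2)
        - n * ((1/2) * ∑ i, L1 n x i * F n i i) - (n : ℝ) ^ 2 * a n *
          ((1/2) * ∑ q : 𝒳 × 𝒳, G q.1 q.2 * L1 n x q.1 * L1 n x q.2)
        = (n : ℝ) ^ 2 * a n * ((1/2) *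
          (∑ q : 𝒳 × 𝒳, (F n q.1 q.2 / a n - G q.1 q.2) * (L1 n x q.1 * L1 n x q.2)
            - (n : ℝ)⁻¹ * ∑ i, F n i i / a n * L1 n x i)) := by
      have hq : ∑ q : 𝒳 × 𝒳, (F n q.1 q.2 / a n - G q.1 q.2) * (L1 n x q.1 * L1 n x q.2)
          = (∑ q : 𝒳 × 𝒳, F n q.1 q.2 * L1 n x q.1 * L1 n x q.2) / a n
            - ∑ q : 𝒳 × 𝒳, G q.1 q.2 * L1 n x q.1 * L1 n x q.2 := by
        rw [Finset.sum_div, ← Finset.sum_sub_distrib]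
        exact Finset.sum_congr rfl fun q _ => by ring
      have hi : ∑ i, F n i i / a n * L1 n x i = (∑ i, L1 n x i * F n i i) / a n := by
        rw [Finset.sum_div]
        exact Finset.sum_congr rfl fun q _ => by ring
      rw [hq, hi]
      field_simp
      ring
    rw [e1, abs_mul, abs_of_pos (by positivity : (0 : ℝ) < n ^ 2 * a n), abs_mul,
      abs_of_pos (by norm_num : (0 : ℝ) < 1/2)]
    dsimp only
    gcongr
    refine (norm_sub_le (E := ℝ) _ _).trans (add_le_add ?_ ?_)
    · rw [Real.norm_eq_abs]
      refine (Finset.abs_sum_le_sum_abs _ _).trans (Finset.sum_le_sum fun q _ => ?_)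
      rw [abs_mul]
      refine mul_le_of_le_one_right (abs_nonneg _) ?_
      rw [abs_of_nonneg (mul_nonneg (hω _) (hω _))]
      exact mul_le_one₀ (hω1 _) (hω _) (hω1 _)
    · rw [Real.norm_eq_abs, abs_mul, abs_of_pos (inv_pos.2 hn')]
      gcongr
      refine (Finset.abs_sum_le_sum_abs _ _).trans (Finset.sum_le_sum fun i _ => ?_)
      rw [abs_mul]
      refine mul_le_of_le_one_right (abs_nonneg _) ?_
      rw [abs_of_nonneg (hω _)]
      exact hω1 _

lemma sum_mul_L2 {n : ℕ} {b : ℝ} (hb : (n : ℝ) ^ 2 * b ≠ 0)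
    (x : (Fin n → 𝒳) × Finset (Fin n × Fin n)) (h : 𝒳 × 𝒳 → ℝ) :
    (n : ℝ) ^ 2 * b * ∑ q, h q * L2 b n x q
      = ∑ e ∈ x.2, (h (x.1 e.1, x.1 e.2) + h (x.1 e.2, x.1 e.1)) := by
  have h1 : ∀ q, (n : ℝ) ^ 2 * b * (h q * L2 b n x q)
      = ∑ e ∈ x.2, ((if (x.1 e.1, x.1 e.2) = q then h q else 0)
          + (if (x.1 e.2, x.1 e.1) = q then h q else 0)) := fun q => by
    rw [mul_left_comm, L2, mul_div_cancel₀ _ hb, Finset.mul_sum]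
    exact Finset.sum_congr rfl fun e _ => by simp [mul_add]
  rw [Finset.mul_sum, Finset.sum_congr rfl fun q _ => h1 q, Finset.sum_comm]
  exact Finset.sum_congr rfl fun e _ => by simp [Finset.sum_add_distrib]

lemma sum_mul_L2_of_symm {n : ℕ} {b : ℝ} (hb : (n : ℝ) ^ 2 * b ≠ 0)
    (x : (Fin n → 𝒳) × Finset (Fin n × Fin n)) {g : 𝒳 × 𝒳 → ℝ}
    (hg : ∀ i j, g (i, j) = g (j, i)) :
    (n : ℝ) ^ 2 * b * ((1/2) * ∑ q, g q * L2 b n x q) = ∑ e ∈ x.2, g (x.1 e.1, x.1 e.2) := by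
  rw [mul_left_comm, sum_mul_L2 hb, Finset.mul_sum]
  refine Finset.sum_congr rfl fun e _ => ?_
  rw [hg (x.1 e.2)]
  ring

lemma L_mem_MSpace {n : ℕ} (hn : 0 < n) {b : ℝ} (hb : 0 < b)
    (x : (Fin n → 𝒳) × Finset (Fin n × Fin n)) : (L1 n x, L2 b n x) ∈ MSpace 𝒳 := by
  refine ⟨L1_nonneg x, sum_L1 hn x, fun q => ?_, fun i j => ?_⟩
  · refine div_nonneg (Finset.sum_nonneg fun e _ => ?_) (by positivity)
    split_ifs <;> norm_num
  · simp only [L2]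
    congr 1
    refine Finset.sum_congr rfl fun e _ => ?_
    rw [add_comm]
    simp only [Prod.mk.injEq, and_comm]

lemma exists_mgf_bound {μ : 𝒳 → ℝ} (hμ0 : ∀ i, 0 < μ i) (hμs : ∑ i, μ i = 1)
    {p : ℕ → 𝒳 → 𝒳 → ℝ} (hp0 : ∀ n i j, 0 ≤ p n i j) (hp1 : ∀ n i j, p n i j ≤ 1)
    (hpsymm : ∀ n i j, p n i j = p n j i) {C : 𝒳 → 𝒳 → ℝ} {a : ℕ → ℝ} (hapos : ∀ n, 0 < a n)
    (hconv : ∀ i j, Tendsto (fun n => p n i j / a n) atTop (nhds (C i j)))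
    {g : 𝒳 × 𝒳 → ℝ} (hg : ∀ i j, g (i, j) = g (j, i)) :
    ∃ ε : ℕ → ℝ, Tendsto ε atTop (nhds 0) ∧ ∀ n, 0 < n →
      ∑ x, graphWeight μ (p n) n x *
          Real.exp ((n : ℝ) ^ 2 * a n * dualFn C g (L1 n x, L2 (a n) n x))
        ≤ Real.exp ((n : ℝ) ^ 2 * a n * ε n) := by
  obtain ⟨ε, hε, happ⟩ := exists_sum_edges_approx hapos
    (F := fun n i j => p n i j * (Real.exp (g (i, j)) - 1))
    (G := fun i j => C i j * (Real.exp (g (i, j)) - 1))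
    (fun n i j => by rw [hpsymm, hg])
    (fun i j => by simpa only [mul_div_right_comm] using (hconv i j).mul_const _)
  refine ⟨ε, hε, fun n hn => ?_⟩
  have hN : (n : ℝ) ^ 2 * a n ≠ 0 := by
    have := hapos n
    positivity
  rw [sum_graphWeight_mul]
  have hσ : ∀ σ : Fin n → 𝒳, ∑ E ∈ (Edges n).powerset,
      bernW (Edges n) (fun e => p n (σ e.1) (σ e.2)) E *
        Real.exp ((n : ℝ) ^ 2 * a n * dualFn C g (L1 n (σ, E), L2 (a n) n (σ, E)))
      ≤ Real.exp ((n : ℝ) ^ 2 * a n * ε n) := by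
    intro σ
    set K := (n : ℝ) ^ 2 * a n * ((1/2) * ∑ q : 𝒳 × 𝒳, C q.1 q.2 * (Real.exp (g (q.1, q.2)) - 1)
      * L1 n (σ, ∅) q.1 * L1 n (σ, ∅) q.2) with hK
    have hE : ∀ E, (n : ℝ) ^ 2 * a n * dualFn C g (L1 n (σ, E), L2 (a n) n (σ, E))
        = ∑ e ∈ E, g (σ e.1, σ e.2) + -K := by
      intro E
      rw [← sum_mul_L2_of_symm hN (σ, E) hg, hK, ← mul_neg, ← mul_add, ← mul_neg, ← mul_add, dualFn,
        ← Finset.sum_neg_distrib, ← Finset.sum_add_distrib]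
      congr 2
      refine Finset.sum_congr rfl fun q _ => ?_
      change _ - C q.1 q.2 * L1 n (σ, ∅) q.1 * L1 n (σ, ∅) q.2 * _ = _
      ring
    simp_rw [hE, Real.exp_add, ← mul_assoc]
    rw [← Finset.sum_mul]
    refine (mul_le_mul_of_nonneg_right (sum_bernW_mul_exp_le (s := Edges n)
      (p := fun e => p n (σ e.1) (σ e.2)) (fun e => hp0 n _ _) (fun e => hp1 n _ _)
      fun e => g (σ e.1, σ e.2)) (Real.exp_pos _).le).trans ?_
    rw [← Real.exp_add]
    refine Real.exp_le_exp.2 ?_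
    have := (abs_le.1 (happ n hn (σ, ∅))).2
    rw [← sub_eq_add_neg]
    exact this
  calc _ ≤ ∑ σ : Fin n → 𝒳, (∏ v, μ (σ v)) * Real.exp ((n : ℝ) ^ 2 * a n * ε n) :=
        Finset.sum_le_sum fun σ _ => mul_le_mul_of_nonneg_left (hσ σ)
          (Finset.prod_nonneg fun v _ => (hμ0 _).le)
    _ = _ := by rw [← Finset.sum_mul, ← Fintype.sum_pow, hμs, one_pow, one_mul]

end Graph

section UpperBound

variable {𝒳 : Type} [Fintype 𝒳]

lemma tendsto_sq_mul_atTop {a : ℕ → ℝ} (hapos : ∀ n, 0 < a n)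
    (hna : Tendsto (fun n : ℕ => (n : ℝ) * a n) atTop atTop) :
    Tendsto (fun n : ℕ => (n : ℝ) ^ 2 * a n) atTop atTop := by
  refine tendsto_atTop_mono' _ ?_ hna
  filter_upwards [eventually_ge_atTop 1] with n hn
  have h1 : (1 : ℝ) ≤ n := by exact_mod_cast hn
  have := mul_pos (by linarith : (0 : ℝ) < n) (hapos n)
  nlinarith

lemma exists_finite_dualFn_cover {C : 𝒳 → 𝒳 → ℝ} (hC0 : ∀ i j, 0 ≤ C i j)
    (hCsymm : ∀ i j, C i j = C j i) {F : Set ((𝒳 → ℝ) × (𝒳 × 𝒳 → ℝ))} (hFM : F ⊆ MSpace 𝒳)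
    (hF : IsClosed F) {c : ℝ} (hc : ∀ z ∈ F, (c : EReal) < I1 C z) :
    ∃ T : Finset (𝒳 × 𝒳 → ℝ), (∀ g ∈ T, ∀ i j, g (i, j) = g (j, i)) ∧
      ∀ z ∈ F, ∃ g ∈ T, c < dualFn C g z := by
  classical
  have hK : IsCompact (F ∩ {z | z ∈ MSpace 𝒳 ∧ dualFn C (fun _ => 1) z ≤ c}) :=
    (isCompact_dualFn_one_le C hC0 c).inter_left hF
  obtain ⟨T, hT⟩ := hK.elim_finite_subcover
    (fun g : {g : 𝒳 × 𝒳 → ℝ // ∀ i j, g (i, j) = g (j, i)} => {z | c < dualFn C g z})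
    (fun g => isOpen_lt continuous_const (continuous_dualFn C g)) (fun z hz => by
      obtain ⟨g, hg, hgz⟩ := exists_lt_dualFn hC0 hCsymm (hFM hz.1) (hc z hz.1)
      exact Set.mem_iUnion.2 ⟨⟨g, hg⟩, hgz⟩)
  refine ⟨insert (fun _ => 1) (T.image Subtype.val), fun g hg => ?_, fun z hz => ?_⟩
  · rcases Finset.mem_insert.1 hg with rfl | hg
    · simp
    · obtain ⟨g, -, rfl⟩ := Finset.mem_image.1 hg
      exact g.2
  · by_cases h : dualFn C (fun _ => 1) z ≤ c
    · have := hT ⟨hz, hFM hz, h⟩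
      simp only [Set.mem_iUnion] at this
      obtain ⟨g, hgT, hg⟩ := this
      exact ⟨g, Finset.mem_insert_of_mem (Finset.mem_image_of_mem _ hgT), hg⟩
    · exact ⟨_, Finset.mem_insert_self _ _, not_le.1 h⟩

lemma eventually_graphPr_le [DecidableEq 𝒳] {μ : 𝒳 → ℝ} (hμ0 : ∀ i, 0 < μ i) (hμs : ∑ i, μ i = 1)
    {p : ℕ → 𝒳 → 𝒳 → ℝ} (hp0 : ∀ n i j, 0 ≤ p n i j) (hp1 : ∀ n i j, p n i j ≤ 1)
    (hpsymm : ∀ n i j, p n i j = p n j i) {C : 𝒳 → 𝒳 → ℝ} (hC0 : ∀ i j, 0 ≤ C i j)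
    (hCsymm : ∀ i j, C i j = C j i) {a : ℕ → ℝ} (hapos : ∀ n, 0 < a n)
    (hconv : ∀ i j, Tendsto (fun n => p n i j / a n) atTop (nhds (C i j)))
    (hna : Tendsto (fun n : ℕ => (n : ℝ) * a n) atTop atTop)
    {F : Set ((𝒳 → ℝ) × (𝒳 × 𝒳 → ℝ))} (hFM : F ⊆ MSpace 𝒳) (hF : IsClosed F) {b c : ℝ}
    (hbc : b < c) (hc : ∀ z ∈ F, (c : EReal) < I1 C z) :
    ∀ᶠ n : ℕ in atTop, graphPr μ (p n) n {x | (L1 n x, L2 (a n) n x) ∈ F}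
      ≤ Real.exp (-((n : ℝ) ^ 2 * a n * b)) := by
  obtain ⟨T, hTs, hTF⟩ := exists_finite_dualFn_cover hC0 hCsymm hFM hF hc
  have hN := tendsto_sq_mul_atTop hapos hna
  have hT : ∀ g ∈ T, ∀ᶠ n : ℕ in atTop, ∑ x, graphWeight μ (p n) n x *
      Real.exp ((n : ℝ) ^ 2 * a n * dualFn C g (L1 n x, L2 (a n) n x))
        ≤ Real.exp ((n : ℝ) ^ 2 * a n * ((c - b) / 2)) := by
    intro g hg
    obtain ⟨ε, hε, hmgf⟩ := exists_mgf_bound hμ0 hμs hp0 hp1 hpsymm hapos hconv (hTs g hg)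
    filter_upwards [hε.eventually (gt_mem_nhds (by linarith : 0 < (c - b) / 2)),
      eventually_gt_atTop 0] with n hεn hn
    refine (hmgf n hn).trans (Real.exp_le_exp.2 ?_)
    have := hapos n
    gcongr
  have hcard : ∀ᶠ n : ℕ in atTop, (T.card : ℝ) ≤ Real.exp ((n : ℝ) ^ 2 * a n * ((c - b) / 2)) :=
    (Real.tendsto_exp_atTop.comp (hN.atTop_mul_const
      (by linarith : 0 < (c - b) / 2))).eventually_ge_atTop _
  filter_upwards [(Filter.eventually_all_finset T).2 hT, hcard] with n hTn hcn
  set N := (n : ℝ) ^ 2 * a n with hNdef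
  have hN0 : 0 ≤ N := mul_nonneg (sq_nonneg _) (hapos n).le
  rw [graphPr_eq_sum]
  calc _ ≤ ∑ x, graphWeight μ (p n) n x *
          ∑ g ∈ T, Real.exp (N * dualFn C g (L1 n x, L2 (a n) n x)) * Real.exp (-(N * c)) := by
        refine Finset.sum_le_sum fun x _ => mul_le_mul_of_nonneg_left ?_
          (graphWeight_nonneg hμ0 (hp0 n) (hp1 n) n x)
        by_cases hx : (L1 n x, L2 (a n) n x) ∈ F
        swap
        · rw [Set.indicator_of_notMem (by exact hx)]
          positivity
        rw [Set.indicator_of_mem (by exact hx)]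
        obtain ⟨g, hgT, hg⟩ := hTF _ hx
        refine le_trans ?_ (Finset.single_le_sum (f := fun g =>
          Real.exp (N * dualFn C g (L1 n x, L2 (a n) n x)) * Real.exp (-(N * c)))
          (fun g _ => by positivity) hgT)
        rw [← Real.exp_add, Pi.one_apply]
        refine Real.one_le_exp ?_
        nlinarith
    _ = ∑ g ∈ T, (∑ x, graphWeight μ (p n) n x *
          Real.exp (N * dualFn C g (L1 n x, L2 (a n) n x))) * Real.exp (-(N * c)) := by
        simp_rw [Finset.mul_sum, Finset.sum_mul]
        rw [Finset.sum_comm]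
        simp_rw [mul_assoc]
    _ ≤ ∑ g ∈ T, Real.exp (N * ((c - b) / 2)) * Real.exp (-(N * c)) :=
        Finset.sum_le_sum fun g hg => by
          have := hTn g hg
          gcongr
    _ = T.card * (Real.exp (N * ((c - b) / 2)) * Real.exp (-(N * c))) := by
        rw [Finset.sum_const, nsmul_eq_mul]
    _ ≤ Real.exp (N * ((c - b) / 2)) * (Real.exp (N * ((c - b) / 2)) * Real.exp (-(N * c))) := by
        gcongr
    _ = _ := by
        rw [← Real.exp_add, ← Real.exp_add]
        congr 1
        ring

end UpperBound

section LowerBound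

variable {𝒳 : Type} [Fintype 𝒳] [DecidableEq 𝒳]

lemma exists_colouring_card {n : ℕ} {k : 𝒳 → ℕ} (hk : ∑ i, k i = n) :
    ∃ σ : Fin n → 𝒳, ∀ i, (Finset.univ.filter fun v => σ v = i).card = k i := by
  let e : (Σ i, Fin (k i)) ≃ Fin n := Fintype.equivFinOfCardEq (by simp [hk])
  refine ⟨fun v => (e.symm v).1, fun i => ?_⟩
  have : (Finset.univ.filter fun v => (e.symm v).1 = i)
      = (Finset.univ.filter fun y : Σ i, Fin (k i) => y.1 = i).map e.toEmbedding := by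
    ext v
    simp
  rw [this, Finset.card_map, Finset.card_filter, Fintype.sum_sigma]
  simp [apply_ite Finset.card]

lemma exists_colouring_tendsto [Nonempty 𝒳] {ω : 𝒳 → ℝ} (h0 : ∀ i, 0 ≤ ω i)
    (h1 : ∑ i, ω i = 1) :
    ∃ σ : ∀ n : ℕ, Fin n → 𝒳, ∀ i, Tendsto (fun n => L1 n (σ n, ∅) i) atTop (nhds (ω i)) := by
  obtain ⟨i₀⟩ := ‹Nonempty 𝒳›
  have hle : ∀ n : ℕ, ∑ i, ⌊ω i * n⌋₊ ≤ n := fun n => by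
    have : ((∑ i, ⌊ω i * n⌋₊ : ℕ) : ℝ) ≤ n := by
      push_cast
      calc _ ≤ ∑ i, ω i * (n : ℝ) :=
            Finset.sum_le_sum fun i _ => Nat.floor_le (mul_nonneg (h0 i) n.cast_nonneg)
        _ = n := by rw [← Finset.sum_mul, h1, one_mul]
    exact_mod_cast this
  have hk : ∀ n : ℕ, ∑ i, (⌊ω i * n⌋₊ + if i = i₀ then n - ∑ j, ⌊ω j * n⌋₊ else 0) = n :=
    fun n => by
      rw [Finset.sum_add_distrib, Finset.sum_ite_eq' Finset.univ i₀, if_pos (Finset.mem_univ _)]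
      exact Nat.add_sub_cancel' (hle n)
  choose σ hσ using fun n => exists_colouring_card (hk n)
  refine ⟨σ, fun i => ?_⟩
  have hfl : ∀ i, Tendsto (fun n : ℕ => (⌊ω i * n⌋₊ : ℝ) / n) atTop (nhds (ω i)) := fun i =>
    (tendsto_nat_floor_mul_div_atTop (h0 i)).comp tendsto_natCast_atTop_atTop
  have hrest : Tendsto (fun n : ℕ => if i = i₀ then 1 - ∑ j, (⌊ω j * n⌋₊ : ℝ) / n else 0) atTop
      (nhds 0) := by
    split_ifs
    · have := (tendsto_finsetSum Finset.univ fun j _ => hfl j).const_sub 1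
      simpa [h1] using this
    · exact tendsto_const_nhds
  have hsum := (hfl i).add hrest
  rw [add_zero] at hsum
  refine hsum.congr' ?_
  filter_upwards [eventually_gt_atTop 0] with n hn
  have hn' : (n : ℝ) ≠ 0 := by positivity
  simp only [L1, hσ n i]
  push_cast [Nat.cast_sub (hle n)]
  rw [add_div, ite_div, sub_div, div_self hn', Finset.sum_div, zero_div]

lemma tendsto_sum_edges {a : ℕ → ℝ} (hapos : ∀ n, 0 < a n) {F : ℕ → 𝒳 → 𝒳 → ℝ}
    (hsymm : ∀ n i j, F n i j = F n j i) {G : 𝒳 → 𝒳 → ℝ}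
    (hF : ∀ i j, Tendsto (fun n => F n i j / a n) atTop (nhds (G i j)))
    {σ : ∀ n : ℕ, Fin n → 𝒳} {ω : 𝒳 → ℝ}
    (hσ : ∀ i, Tendsto (fun n => L1 n (σ n, ∅) i) atTop (nhds (ω i))) :
    Tendsto (fun n : ℕ => (∑ e ∈ Edges n, F n (σ n e.1) (σ n e.2)) / ((n : ℝ) ^ 2 * a n)) atTop
      (nhds ((1/2) * ∑ q : 𝒳 × 𝒳, G q.1 q.2 * ω q.1 * ω q.2)) := by
  obtain ⟨ε, hε, happ⟩ := exists_sum_edges_approx hapos hsymm hF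
  have hlim : Tendsto (fun n : ℕ => (1/2) * ∑ q : 𝒳 × 𝒳,
      G q.1 q.2 * L1 n (σ n, ∅) q.1 * L1 n (σ n, ∅) q.2) atTop
      (nhds ((1/2) * ∑ q : 𝒳 × 𝒳, G q.1 q.2 * ω q.1 * ω q.2)) :=
    (tendsto_finsetSum _ fun q _ => ((hσ q.1).const_mul _).mul (hσ q.2)).const_mul _
  have hdiff : Tendsto (fun n : ℕ => (∑ e ∈ Edges n, F n (σ n e.1) (σ n e.2)) / ((n : ℝ) ^ 2 * a n)
      - (1/2) * ∑ q : 𝒳 × 𝒳, G q.1 q.2 * L1 n (σ n, ∅) q.1 * L1 n (σ n, ∅) q.2) atTop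
      (nhds 0) := by
    refine squeeze_zero_norm' ?_ hε
    filter_upwards [eventually_gt_atTop 0] with n hn
    have hN : 0 < (n : ℝ) ^ 2 * a n := by
      have := hapos n
      positivity
    rw [div_sub' hN.ne', Real.norm_eq_abs, abs_div, abs_of_pos hN, div_le_iff₀' hN]
    exact happ n hn (σ n, ∅)
  simpa using hdiff.add hlim

open Classical in
lemma eventually_L2_tail_le {a : ℕ → ℝ} (hapos : ∀ n, 0 < a n)
    (hna : Tendsto (fun n : ℕ => (n : ℝ) * a n) atTop atTop)
    {p : ℕ → 𝒳 → 𝒳 → ℝ} (hp0 : ∀ n i j, 0 ≤ p n i j) (hp1 : ∀ n i j, p n i j ≤ 1)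
    (hpsymm : ∀ n i j, p n i j = p n j i) {C : 𝒳 → 𝒳 → ℝ}
    (hC : ∀ i j, C i j = C j i) (hconv : ∀ i j, Tendsto (fun n => p n i j / a n) atTop (nhds (C i j)))
    {σ : ∀ n : ℕ, Fin n → 𝒳} {ω : 𝒳 → ℝ}
    (hσ : ∀ i, Tendsto (fun n => L1 n (σ n, ∅) i) atTop (nhds (ω i))) (q : 𝒳 × 𝒳) {δ : ℝ}
    (hδ : 0 < δ) {η : ℝ} (hη : 0 < η) :
    ∀ᶠ n : ℕ in atTop, ∑ E ∈ (Edges n).powerset with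
      δ ≤ |L2 (a n) n (σ n, E) q - C q.1 q.2 * ω q.1 * ω q.2|,
        bernW (Edges n) (fun e => p n (σ n e.1) (σ n e.2)) E ≤ η := by
  set ind : 𝒳 → 𝒳 → ℝ := fun i j => (if (i, j) = q then 1 else 0) + (if (j, i) = q then 1 else 0)
    with hind
  have hind2 : ∀ i j, |ind i j| ≤ 2 := fun i j => by
    simp only [hind]
    split_ifs <;> norm_num
  have hmean := tendsto_sum_edges hapos (F := fun n i j => p n i j * ind i j)
    (G := fun i j => C i j * ind i j)
    (fun n i j => by simp only [hind, hpsymm n i j, add_comm (if (i, j) = q then (1 : ℝ) else 0)])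
    (fun i j => by simpa only [mul_div_right_comm] using (hconv i j).mul_const _) hσ
  have hlim : (1/2) * ∑ r : 𝒳 × 𝒳, C r.1 r.2 * ind r.1 r.2 * ω r.1 * ω r.2
      = C q.1 q.2 * ω q.1 * ω q.2 := by
    have hr : ∀ r : 𝒳 × 𝒳, C r.1 r.2 * ind r.1 r.2 * ω r.1 * ω r.2
        = (if r = q then C r.1 r.2 * ω r.1 * ω r.2 else 0)
          + (if r = q.swap then C r.1 r.2 * ω r.1 * ω r.2 else 0) := by
      intro r
      have : (r.2, r.1) = q ↔ r = q.swap := by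
        constructor
        · rintro rfl
          rfl
        · rintro rfl
          rfl
      simp only [hind, this, Prod.mk.eta]
      split_ifs <;> ring
    rw [Finset.sum_congr rfl fun r _ => hr r, Finset.sum_add_distrib]
    simp only [Finset.sum_ite_eq', Finset.mem_univ, if_true, Prod.fst_swap, Prod.snd_swap]
    rw [hC q.2]
    ring
  rw [hlim] at hmean
  have htot := tendsto_sum_edges hapos hpsymm hconv hσ
  set K := |(1/2) * ∑ r : 𝒳 × 𝒳, C r.1 r.2 * ω r.1 * ω r.2| + 1 with hK
  have hK0 : 0 < K := by positivity
  have hKlt : (1/2) * ∑ r : 𝒳 × 𝒳, C r.1 r.2 * ω r.1 * ω r.2 < K :=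
    (le_abs_self _).trans_lt (lt_add_one _)
  set t := min (1/2) (δ / (16 * K))
  have ht0 : 0 < t := by positivity
  have ht1 : 2 * t ≤ 1 := by linarith [min_le_left (1/2) (δ / (16 * K))]
  have ht2 : 16 * K * t ≤ δ := by
    have := min_le_right (1/2) (δ / (16 * K))
    rw [le_div_iff₀ (by positivity)] at this
    linarith
  have hexp : Tendsto (fun n : ℕ => 2 * Real.exp (-((n : ℝ) ^ 2 * a n * (t * δ / 4)))) atTop
      (nhds (2 * 0)) :=
    ((Real.tendsto_exp_neg_atTop_nhds_zero.comp
      ((tendsto_sq_mul_atTop hapos hna).atTop_mul_const (by positivity))).const_mul 2)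
  rw [mul_zero] at hexp
  filter_upwards [eventually_gt_atTop 0, hexp.eventually (gt_mem_nhds hη),
    htot.eventually (gt_mem_nhds hKlt),
    hmean.eventually (Metric.ball_mem_nhds _ (half_pos hδ))] with n hn hexpn htotn hmeann
  set N := (n : ℝ) ^ 2 * a n with hNdef
  have hN : 0 < N := by
    have := hapos n
    positivity
  rw [div_lt_iff₀ hN] at htotn
  rw [Real.dist_eq] at hmeann
  have htail := bernW_two_sided_tail (s := Edges n) (p := fun e => p n (σ n e.1) (σ n e.2))
    (fun e => hp0 n _ _) (fun e => hp1 n _ _) (fun e => ind (σ n e.1) (σ n e.2))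
    (fun e => hind2 _ _) ht0 ht1 (N * (δ / 2))
  refine le_trans ?_ (htail.trans (le_trans ?_ hexpn.le))
  · refine Finset.sum_le_sum_of_subset_of_nonneg ?_
      (fun E _ _ => bernW_nonneg (fun e => hp0 n _ _) (fun e => hp1 n _ _) E)
    intro E hE
    rw [Finset.mem_filter] at hE ⊢
    refine ⟨hE.1, ?_⟩
    have hL2 : L2 (a n) n (σ n, E) q = (∑ e ∈ E, ind (σ n e.1) (σ n e.2)) / N := rfl
    set m := ∑ e ∈ Edges n, p n (σ n e.1) (σ n e.2) * ind (σ n e.1) (σ n e.2)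
    have htri := abs_sub_le (L2 (a n) n (σ n, E) q) (m / N) (C q.1 q.2 * ω q.1 * ω q.2)
    have h2 : δ / 2 ≤ |L2 (a n) n (σ n, E) q - m / N| := by linarith [hE.2]
    rwa [hL2, ← sub_div, abs_div, abs_of_pos hN, le_div_iff₀' hN] at h2
  · gcongr
    have h1 : (2 * t) ^ 2 * ∑ e ∈ Edges n, p n (σ n e.1) (σ n e.2) ≤ (2 * t) ^ 2 * (K * N) := by
      gcongr
    have h2 : N * t * (16 * K * t) ≤ N * t * δ := by gcongr
    nlinarith

open Classical in
lemma eventually_half_le_bernW {a : ℕ → ℝ} (hapos : ∀ n, 0 < a n)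
    (hna : Tendsto (fun n : ℕ => (n : ℝ) * a n) atTop atTop)
    {p : ℕ → 𝒳 → 𝒳 → ℝ} (hp0 : ∀ n i j, 0 ≤ p n i j) (hp1 : ∀ n i j, p n i j ≤ 1)
    (hpsymm : ∀ n i j, p n i j = p n j i) {C : 𝒳 → 𝒳 → ℝ}
    (hC : ∀ i j, C i j = C j i) (hconv : ∀ i j, Tendsto (fun n => p n i j / a n) atTop (nhds (C i j)))
    {σ : ∀ n : ℕ, Fin n → 𝒳} {ω : 𝒳 → ℝ}
    (hσ : ∀ i, Tendsto (fun n => L1 n (σ n, ∅) i) atTop (nhds (ω i)))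
    {V : Set ((𝒳 → ℝ) × (𝒳 × 𝒳 → ℝ))} (hV : IsOpen V)
    (hωV : (ω, fun q : 𝒳 × 𝒳 => C q.1 q.2 * ω q.1 * ω q.2) ∈ V) :
    ∀ᶠ n : ℕ in atTop, 1/2 ≤ ∑ E ∈ (Edges n).powerset with
      (L1 n (σ n, E), L2 (a n) n (σ n, E)) ∈ V,
        bernW (Edges n) (fun e => p n (σ n e.1) (σ n e.2)) E := by
  obtain ⟨δ, hδ, hball⟩ := Metric.isOpen_iff.1 hV _ hωV
  have hη : 0 < 1 / (2 * ((Fintype.card (𝒳 × 𝒳) : ℝ) + 1)) := by positivity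
  have htail := Filter.eventually_all.2 fun q =>
    eventually_L2_tail_le hapos hna hp0 hp1 hpsymm hC hconv hσ q hδ hη
  have hL1 := Filter.eventually_all.2 fun i => (hσ i).eventually (Metric.ball_mem_nhds _ hδ)
  filter_upwards [htail, hL1] with n htn hLn
  have hw : ∀ E, 0 ≤ bernW (Edges n) (fun e => p n (σ n e.1) (σ n e.2)) E := fun E =>
    bernW_nonneg (fun e => hp0 n _ _) (fun e => hp1 n _ _) E
  set W := bernW (Edges n) (fun e => p n (σ n e.1) (σ n e.2))
  have hcover : 1 ≤ ∑ E ∈ (Edges n).powerset with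
      (L1 n (σ n, E), L2 (a n) n (σ n, E)) ∈ V, W E + ∑ q : 𝒳 × 𝒳,
        ∑ E ∈ (Edges n).powerset with
          δ ≤ |L2 (a n) n (σ n, E) q - C q.1 q.2 * ω q.1 * ω q.2|, W E := by
    rw [← sum_bernW (Edges n) (fun e => p n (σ n e.1) (σ n e.2))]
    simp only [Finset.sum_filter]
    rw [Finset.sum_comm, ← Finset.sum_add_distrib]
    refine Finset.sum_le_sum fun E _ => ?_
    have hterm : ∀ q ∈ (Finset.univ : Finset (𝒳 × 𝒳)), 0 ≤ if
        δ ≤ |L2 (a n) n (σ n, E) q - C q.1 q.2 * ω q.1 * ω q.2| then W E else 0 := fun q _ => by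
      split_ifs
      exacts [hw E, le_rfl]
    by_cases h : (L1 n (σ n, E), L2 (a n) n (σ n, E)) ∈ V
    · rw [if_pos h]
      exact le_add_of_nonneg_right (Finset.sum_nonneg hterm)
    · have : ∃ q : 𝒳 × 𝒳, δ ≤ |L2 (a n) n (σ n, E) q - C q.1 q.2 * ω q.1 * ω q.2| := by
        by_contra! hcon
        refine h (hball ?_)
        rw [Metric.mem_ball, Prod.dist_eq, max_lt_iff, dist_pi_lt_iff hδ, dist_pi_lt_iff hδ]
        exact ⟨hLn, hcon⟩
      obtain ⟨q, hq⟩ := this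
      rw [if_neg h, zero_add]
      have := Finset.single_le_sum hterm (Finset.mem_univ q)
      rwa [if_pos hq] at this
  have hle := Finset.sum_le_sum fun q (_ : q ∈ (Finset.univ : Finset (𝒳 × 𝒳))) => htn q
  rw [Finset.sum_const, nsmul_eq_mul, Finset.card_univ] at hle
  have hsmall : (Fintype.card (𝒳 × 𝒳) : ℝ) * (1 / (2 * ((Fintype.card (𝒳 × 𝒳) : ℝ) + 1)))
      ≤ 1/2 := by
    rw [mul_one_div, div_le_div_iff₀ (by positivity) (by norm_num)]
    linarith
  linarith

lemma eventually_tilt_lower_bound [Nonempty 𝒳] {μ : 𝒳 → ℝ} (hμ0 : ∀ i, 0 < μ i)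
    {p : ℕ → 𝒳 → 𝒳 → ℝ} (hp0 : ∀ n i j, 0 ≤ p n i j) (hp1 : ∀ n i j, p n i j ≤ 1)
    (hpsymm : ∀ n i j, p n i j = p n j i) {C : 𝒳 → 𝒳 → ℝ} (hCsymm : ∀ i j, C i j = C j i)
    {a : ℕ → ℝ} (hapos : ∀ n, 0 < a n)
    (hconv : ∀ i j, Tendsto (fun n => p n i j / a n) atTop (nhds (C i j)))
    (ha0 : Tendsto a atTop (nhds 0))
    (hna : Tendsto (fun n : ℕ => (n : ℝ) * a n) atTop atTop)
    {U : Set ((𝒳 → ℝ) × (𝒳 × 𝒳 → ℝ))} (hU : IsOpen U) {z : (𝒳 → ℝ) × (𝒳 × 𝒳 → ℝ)}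
    (hzU : z ∈ U) (hzM : z ∈ MSpace 𝒳) {g : 𝒳 × 𝒳 → ℝ} (hg : ∀ i j, g (i, j) = g (j, i))
    (hgz : ∀ q : 𝒳 × 𝒳, C q.1 q.2 * z.1 q.1 * z.1 q.2 * Real.exp (g q) = z.2 q)
    {c : ℝ} (hc : dualFn C g z < c) :
    ∀ᶠ n : ℕ in atTop, Real.exp (-((n : ℝ) ^ 2 * a n * c))
      ≤ graphPr μ (p n) n {x | (L1 n x, L2 (a n) n x) ∈ U ∩ MSpace 𝒳} := by
  classical
  obtain ⟨b, hzb, hbc⟩ := exists_between hc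
  set η := (c - b) / 3 with hη
  have hη0 : 0 < η := by
    have : 0 < c - b := sub_pos.2 hbc
    positivity
  obtain ⟨σ, hσ⟩ := exists_colouring_tendsto hzM.1 hzM.2.1
  obtain ⟨i₀, hi₀⟩ := Finite.exists_min μ
  set D : ℕ → 𝒳 → 𝒳 → ℝ := fun n i j => 1 - p n i j + p n i j * Real.exp (g (i, j)) with hD
  have hD0 : ∀ n i j, 0 < D n i j := fun n i j => by
    have h1 := Real.exp_pos (g (i, j))
    rcases (hp0 n i j).eq_or_lt with h | h
    · simp [hD, ← h]
    · have := mul_pos h h1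
      have := hp1 n i j
      simp only [hD]
      linarith
  have hDsymm : ∀ n i j, D n i j = D n j i := fun n i j => by simp only [hD, hpsymm n i j, hg i j]
  have hDlim : ∀ i j, Tendsto (fun n => D n i j) atTop (nhds 1) := fun i j => by
    have hp : Tendsto (fun n => p n i j) atTop (nhds 0) := by
      have := (hconv i j).mul ha0
      rw [mul_zero] at this
      exact this.congr fun n => div_mul_cancel₀ _ (hapos n).ne'
    simpa using (hp.const_sub 1).add (hp.mul_const (Real.exp (g (i, j))))
  have hV : IsOpen (U ∩ {w | dualFn C g w < b}) :=
    hU.inter (isOpen_lt (continuous_dualFn C g) continuous_const)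
  have hhalf := eventually_half_le_bernW hapos hna
    (p := fun n i j => p n i j * Real.exp (g (i, j)) / D n i j)
    (C := fun i j => C i j * Real.exp (g (i, j)))
    (fun n i j => div_nonneg (mul_nonneg (hp0 n i j) (Real.exp_pos _).le) (hD0 n i j).le)
    (fun n i j => (div_le_one (hD0 n i j)).2 (by linarith [hp1 n i j]))
    (fun n i j => by rw [hDsymm, hpsymm, hg]) (fun i j => by rw [hCsymm, hg])
    (fun i j => by
      have := ((hconv i j).mul_const (Real.exp (g (i, j)))).div (hDlim i j) one_ne_zero
      rw [div_one] at this
      refine this.congr fun n => ?_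
      rw [Pi.div_apply]
      ring) hσ hV (by
      have : (z.1, fun q : 𝒳 × 𝒳 => C q.1 q.2 * Real.exp (g (q.1, q.2)) * z.1 q.1 * z.1 q.2)
          = z := by
        refine Prod.ext rfl (funext fun q => ?_)
        rw [← hgz q]
        ring
      rw [this]
      exact ⟨hzU, hzb⟩)
  obtain ⟨ε, hε, happ⟩ := exists_sum_edges_approx hapos
    (F := fun n i j => p n i j * (Real.exp (g (i, j)) - 1) / D n i j)
    (G := fun i j => C i j * (Real.exp (g (i, j)) - 1))
    (fun n i j => by rw [hDsymm, hpsymm, hg])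
    (fun i j => by
      have := ((hconv i j).mul_const (Real.exp (g (i, j)) - 1)).div (hDlim i j) one_ne_zero
      rw [div_one] at this
      refine this.congr fun n => ?_
      rw [Pi.div_apply]
      ring)
  filter_upwards [hhalf, eventually_gt_atTop 0, hε.eventually (gt_mem_nhds hη0),
    hna.eventually_ge_atTop (-Real.log (μ i₀) / η),
    (tendsto_sq_mul_atTop hapos hna).eventually_ge_atTop (Real.log 2 / η)]
    with n hhn hn hεn hcol hlog2
  set N := (n : ℝ) ^ 2 * a n with hNdef
  have hN : 0 < N := by
    have := hapos n
    positivity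
  rw [div_le_iff₀ hη0] at hcol hlog2
  have hcolour : Real.exp (-(N * η)) ≤ ∏ v, μ (σ n v) := by
    calc _ ≤ Real.exp (n * Real.log (μ i₀)) := by
          refine Real.exp_le_exp.2 ?_
          have : (n : ℝ) * -Real.log (μ i₀) ≤ n * (n * a n * η) := by gcongr
          rw [hNdef]
          linarith
      _ = ∏ _v : Fin n, μ i₀ := by
          rw [Real.exp_nat_mul, Real.exp_log (hμ0 i₀)]
          simp
      _ ≤ _ := Finset.prod_le_prod (fun _ _ => (hμ0 _).le) fun v _ => hi₀ _
  have htilt : ∀ E ∈ (Edges n).powerset, dualFn C g (L1 n (σ n, E), L2 (a n) n (σ n, E)) < b →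
      Real.exp (-(N * (b + η))) * bernW (Edges n) (fun e => p n (σ n e.1) (σ n e.2) *
        Real.exp (g (σ n e.1, σ n e.2)) / D n (σ n e.1) (σ n e.2)) E
      ≤ bernW (Edges n) (fun e => p n (σ n e.1) (σ n e.2)) E := by
    intro E hE hb
    have hmul := bernW_mul_prod_eq_tilt (Finset.mem_powerset.1 hE)
      (fun e => p n (σ n e.1) (σ n e.2)) (fun e => Real.exp (g (σ n e.1, σ n e.2)))
      (fun e => (hD0 n _ _).ne')
    rw [← Real.exp_sum, ← sum_mul_L2_of_symm hN.ne' (σ n, E) hg] at hmul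
    have hZ : Real.exp (∑ e ∈ Edges n, p n (σ n e.1) (σ n e.2) *
          (Real.exp (g (σ n e.1, σ n e.2)) - 1) / D n (σ n e.1) (σ n e.2))
        ≤ ∏ e ∈ Edges n, D n (σ n e.1) (σ n e.2) := by
      rw [Real.exp_sum]
      refine Finset.prod_le_prod (fun _ _ => (Real.exp_pos _).le) fun e _ => ?_
      have hpos := hD0 n (σ n e.1) (σ n e.2)
      rw [← Real.le_log_iff_exp_le hpos]
      refine le_trans (le_of_eq ?_) (Real.one_sub_inv_le_log_of_pos hpos)
      rw [eq_sub_iff_add_eq, inv_eq_one_div, ← add_div, div_eq_one_iff_eq hpos.ne']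
      simp only [hD]
      ring
    have hsum := (abs_le.1 (happ n hn (σ n, E))).1
    have hW : 0 ≤ bernW (Edges n) (fun e => p n (σ n e.1) (σ n e.2) *
        Real.exp (g (σ n e.1, σ n e.2)) / D n (σ n e.1) (σ n e.2)) E :=
      bernW_nonneg
        (fun e => div_nonneg (mul_nonneg (hp0 n _ _) (Real.exp_pos _).le) (hD0 n _ _).le)
        (fun e => (div_le_one (hD0 n _ _)).2 (by linarith [hp1 n (σ n e.1) (σ n e.2)])) E
    refine le_of_mul_le_mul_right ?_
      (Real.exp_pos (N * ((1/2) * ∑ q, g q * L2 (a n) n (σ n, E) q)))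
    rw [hmul, mul_right_comm, ← Real.exp_add]
    refine mul_le_mul_of_nonneg_right (le_trans (Real.exp_le_exp.2 ?_) hZ) hW
    have hdual : dualFn C g (L1 n (σ n, E), L2 (a n) n (σ n, E))
        = (1/2) * ∑ q, g q * L2 (a n) n (σ n, E) q - (1/2) * ∑ q : 𝒳 × 𝒳,
          C q.1 q.2 * (Real.exp (g (q.1, q.2)) - 1) * L1 n (σ n, E) q.1 * L1 n (σ n, E) q.2 := by
      rw [dualFn, Finset.sum_sub_distrib, mul_sub]
      congr 2
      exact Finset.sum_congr rfl fun q _ => by ring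
    have h1 : N * dualFn C g (L1 n (σ n, E), L2 (a n) n (σ n, E)) ≤ N * b := by gcongr
    have h2 : N * ε n ≤ N * η := by gcongr
    rw [hdual] at h1
    simp only at hsum
    linarith
  have hgood : Real.exp (-(N * (b + η))) * (1/2) ≤ ∑ E ∈ (Edges n).powerset,
      bernW (Edges n) (fun e => p n (σ n e.1) (σ n e.2)) E *
        Set.indicator {x | (L1 n x, L2 (a n) n x) ∈ U ∩ MSpace 𝒳} 1 (σ n, E) := by
    refine (mul_le_mul_of_nonneg_left hhn (Real.exp_pos _).le).trans ?_
    rw [Finset.sum_filter, Finset.mul_sum]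
    refine Finset.sum_le_sum fun E hE => ?_
    split_ifs with h
    · rw [Set.indicator_of_mem (by exact ⟨h.1, L_mem_MSpace hn (hapos n) _⟩), Pi.one_apply, mul_one]
      exact htilt E hE h.2
    · rw [mul_zero]
      exact mul_nonneg (bernW_nonneg (fun e => hp0 n _ _) (fun e => hp1 n _ _) E)
        (Set.indicator_nonneg (fun _ _ => zero_le_one) _)
  rw [graphPr_eq_sum, sum_graphWeight_mul]
  calc Real.exp (-(N * c))
      ≤ Real.exp (-(N * η)) * (Real.exp (-(N * (b + η))) * (1/2)) := by
        have : Real.exp (-Real.log 2) = 1/2 := by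
          rw [Real.exp_neg, Real.exp_log two_pos]
          norm_num
        rw [← this, ← Real.exp_add, ← Real.exp_add]
        refine Real.exp_le_exp.2 ?_
        have : c = b + 3 * η := by rw [hη]; ring
        rw [this]
        linarith
    _ ≤ (∏ v, μ (σ n v)) * ∑ E ∈ (Edges n).powerset,
        bernW (Edges n) (fun e => p n (σ n e.1) (σ n e.2)) E *
        Set.indicator {x | (L1 n x, L2 (a n) n x) ∈ U ∩ MSpace 𝒳} 1 (σ n, E) := by
        gcongr
        exact Finset.prod_nonneg fun v _ => (hμ0 _).le
    _ ≤ _ := by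
        refine Finset.single_le_sum (f := fun σ : Fin n → 𝒳 => (∏ v, μ (σ v)) *
          ∑ E ∈ (Edges n).powerset, bernW (Edges n) (fun e => p n (σ e.1) (σ e.2)) E *
          Set.indicator {x | (L1 n x, L2 (a n) n x) ∈ U ∩ MSpace 𝒳} 1 (σ, E))
          (fun τ _ => ?_) (Finset.mem_univ (σ n))
        refine mul_nonneg (Finset.prod_nonneg fun v _ => (hμ0 _).le)
          (Finset.sum_nonneg fun E _ => ?_)
        exact mul_nonneg (bernW_nonneg (fun e => hp0 n _ _) (fun e => hp1 n _ _) E)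
          (Set.indicator_nonneg (fun _ _ => zero_le_one) _)

end LowerBound

lemma exists_tilt_near {𝒳 : Type} [Fintype 𝒳] {C : 𝒳 → 𝒳 → ℝ} (hC0 : ∀ i j, 0 ≤ C i j)
    (hCsymm : ∀ i j, C i j = C j i) {U : Set ((𝒳 → ℝ) × (𝒳 × 𝒳 → ℝ))} (hU : IsOpen U)
    {z : (𝒳 → ℝ) × (𝒳 × 𝒳 → ℝ)} (hzU : z ∈ U) (hzM : z ∈ MSpace 𝒳) {c : ℝ}
    (hc : (I1 C z : EReal) < c) :
    ∃ g : 𝒳 × 𝒳 → ℝ, (∀ i j, g (i, j) = g (j, i)) ∧ ∃ y ∈ U ∩ MSpace 𝒳,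
      (∀ q : 𝒳 × 𝒳, C q.1 q.2 * y.1 q.1 * y.1 q.2 * Real.exp (g q) = y.2 q) ∧
      dualFn C g y < c := by
  have hac : ∀ q : 𝒳 × 𝒳, C q.1 q.2 * z.1 q.1 * z.1 q.2 = 0 → z.2 q = 0 := by
    by_contra h
    simp [I1_eq_top h] at hc
  rw [I1_eq_coe hC0 hzM hac, EReal.coe_lt_coe_iff] at hc
  set y : ℝ → 𝒳 × 𝒳 → ℝ := fun δ q => z.2 q + δ * (C q.1 q.2 * z.1 q.1 * z.1 q.2) with hy
  have h1 := tendsto_dualFn_tiltFn hC0 hzM hac y (tendsto_mul_tiltFn_add hac)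
  have h2 : Tendsto (fun δ => (z.1, y δ)) (nhdsWithin 0 (Set.Ioi 0)) (nhds z) := by
    refine tendsto_nhdsWithin_of_tendsto_nhds (Continuous.tendsto' (by fun_prop) _ _ ?_)
    simp [hy]
  obtain ⟨δ, hδc, hδU, hδ⟩ := ((h1.eventually (gt_mem_nhds hc)).and
    ((h2.eventually (hU.mem_nhds hzU)).and self_mem_nhdsWithin)).exists
  refine ⟨tiltFn C z δ, tiltFn_symm hCsymm hzM δ, (z.1, y δ), ⟨hδU, hzM.1, hzM.2.1, fun q => ?_,
    fun i j => ?_⟩, fun q => mul_exp_tiltFn hC0 hzM hac hδ q, hδc⟩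
  · exact add_nonneg (hzM.2.2.1 q) (mul_nonneg (le_of_lt hδ)
      (mul_nonneg (mul_nonneg (hC0 _ _) (hzM.1 _)) (hzM.1 _)))
  · simp only [hy, hzM.2.2.2 i j, hCsymm i j, mul_right_comm (C j i) (z.1 i)]

lemma mul_elog_le {N x c : ℝ} (hN : 0 < N) (h : x ≤ Real.exp (-(N * c))) :
    ((1 / N : ℝ) : EReal) * elog x ≤ ((-c : ℝ) : EReal) := by
  have hN' : 0 < 1 / N := by positivity
  rw [elog]
  split_ifs with hx
  · rw [EReal.coe_mul_bot_of_pos hN']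
    exact bot_le
  · rw [← EReal.coe_mul, EReal.coe_le_coe_iff]
    have := (Real.log_le_iff_le_exp (not_le.1 hx)).2 h
    rw [one_div_mul_eq_div, div_le_iff₀ hN]
    linarith

lemma le_mul_elog {N x c : ℝ} (hN : 0 < N) (h : Real.exp (-(N * c)) ≤ x) :
    ((-c : ℝ) : EReal) ≤ ((1 / N : ℝ) : EReal) * elog x := by
  have hx : 0 < x := (Real.exp_pos _).trans_le h
  rw [elog, if_neg (not_le.2 hx), ← EReal.coe_mul, EReal.coe_le_coe_iff]
  have := (Real.le_log_iff_exp_le hx).2 h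
  rw [one_div_mul_eq_div, le_div_iff₀ hN]
  linarith

end CRG

/-- **LDP for (L¹,L²) in the supercritical regime at speed `aₙ n²`** (Theorem 2.4(i)):
`(L¹,L²)` satisfies an LDP in `ℳ(𝒳) × ℳ̃_*(𝒳×𝒳)` with speed `aₙ n²` and good rate
function `I₁(ω,ϖ) = ½ 𝔥_C(ϖ‖ω)`: `I₁` is lower semicontinuous on the space with compact
level sets, the upper bound holds for closed sets and the lower bound for open sets
(in the subspace topology). -/
theorem ldp_supercritical_speed_an_nsq
    {𝒳 : Type} [Fintype 𝒳] [DecidableEq 𝒳] [Nonempty 𝒳]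
    (μ : 𝒳 → ℝ) (hμ0 : ∀ a, 0 < μ a) (hμ1 : ∀ a, μ a ≤ 1) (hμs : ∑ a, μ a = 1)
    (p : ℕ → 𝒳 → 𝒳 → ℝ) (hp0 : ∀ n a b, 0 ≤ p n a b) (hp1 : ∀ n a b, p n a b ≤ 1)
    (hpsymm : ∀ n a b, p n a b = p n b a)
    (C : 𝒳 → 𝒳 → ℝ) (hC0 : ∀ a b, 0 ≤ C a b) (hCsymm : ∀ a b, C a b = C b a)
    (a : ℕ → ℝ) (hapos : ∀ n, 0 < a n)
    (hconv : ∀ i j, Filter.Tendsto (fun n => p n i j / a n) Filter.atTop (nhds (C i j)))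
    (ha0 : Filter.Tendsto a Filter.atTop (nhds 0))
    (hna : Filter.Tendsto (fun n : ℕ => (n : ℝ) * a n) Filter.atTop Filter.atTop)
    :
    LowerSemicontinuousOn (I1 C) (MSpace 𝒳) ∧
    (∀ c : ℝ, IsCompact {z | z ∈ MSpace 𝒳 ∧ I1 C z ≤ ENNReal.ofReal c}) ∧
    (∀ F : Set ((𝒳 → ℝ) × (𝒳 × 𝒳 → ℝ)), F ⊆ MSpace 𝒳 → IsClosed F →
      Filter.limsup (fun n : ℕ => ((1 / (a n * (n:ℝ)^2) : ℝ) : EReal) *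
          elog (graphPr μ (p n) n {x | (L1 n x, L2 (a n) n x) ∈ F})) Filter.atTop
        ≤ - ⨅ z ∈ F, (I1 C z : EReal)) ∧
    (∀ U : Set ((𝒳 → ℝ) × (𝒳 × 𝒳 → ℝ)), IsOpen U →
      - ⨅ z ∈ U ∩ MSpace 𝒳, (I1 C z : EReal)
        ≤ Filter.liminf (fun n : ℕ => ((1 / (a n * (n:ℝ)^2) : ℝ) : EReal) *
          elog (graphPr μ (p n) n {x | (L1 n x, L2 (a n) n x) ∈ U ∩ MSpace 𝒳})) Filter.atTop) := by
  have hN : ∀ᶠ n : ℕ in atTop, 0 < a n * (n : ℝ) ^ 2 := by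
    filter_upwards [eventually_gt_atTop 0] with n hn
    have := hapos n
    positivity
  refine ⟨lowerSemicontinuousOn_I1 hC0 hCsymm, isCompact_I1_le hC0 hCsymm, fun F hFM hF => ?_,
    fun U hU => ?_⟩
  · refine EReal.le_neg_of_le_neg (EReal.ge_of_forall_gt_iff_ge.1 fun c hc => ?_)
    obtain ⟨d, hcd, hd⟩ := EReal.lt_iff_exists_real_btwn.1 hc
    refine EReal.le_neg_of_le_neg ?_
    have hev := eventually_graphPr_le hμ0 hμs hp0 hp1 hpsymm hC0 hCsymm hapos hconv hna hFM hF
      (EReal.coe_lt_coe_iff.1 hcd) (fun z hz => hd.trans_le (iInf₂_le z hz))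
    refine limsup_le_of_le (by isBoundedDefault) ?_
    filter_upwards [hev, hN] with n hn hNn
    rw [← EReal.coe_neg]
    exact mul_elog_le hNn (by rwa [mul_comm (a n)])
  · refine EReal.neg_le_of_neg_le (le_iInf₂ fun z hz => ?_)
    refine EReal.le_of_forall_lt_iff_le.1 fun c hc => ?_
    refine EReal.neg_le_of_neg_le ?_
    obtain ⟨g, hg, y, hy, hgy, hyc⟩ := exists_tilt_near hC0 hCsymm hU hz.1 hz.2 hc
    have hev := eventually_tilt_lower_bound hμ0 hp0 hp1 hpsymm hCsymm hapos hconv ha0 hna hU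
      hy.1 hy.2 hg hgy hyc
    refine le_liminf_of_le (by isBoundedDefault) ?_
    filter_upwards [hev, hN] with n hn hNn
    rw [← EReal.coe_neg]
    exact le_mul_elog hNn (by rwa [mul_comm (a n)])
end
end

section
/- Let X be a coloured random graph with colour law μ on a finite set 𝒳 and connection probabilities p_n satisfying a_n^{-1}·p_n(a,b) → C(a,b) for all a,b ∈ 𝒳, for some symmetric C : 𝒳×𝒳 → [0,∞) and a sequence (a_n) of positive reals with a_n → 0. Then for every α > 0 there exists N ∈ ℕ such that limsup_{n→∞} (1/(a_n·n²))·log ℙ{ |E| > a_n·n²·N } ≤ −α, where |E| is the number of edges of X. -/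
open Filter
open scoped ENNReal

noncomputable section

open CRG

namespace CRG

/-- The exponential moment of the size of a random subset of `s` that contains each `e ∈ s`
independently with probability `q e`. -/
theorem sum_exp_card_mul_prod {ι : Type*} [Fintype ι] [DecidableEq ι] (s : Finset ι)
    (q : ι → ℝ) :
    ∑ E : Finset ι, Real.exp E.card * ((if E ⊆ s then 1 else 0) *
      ∏ e ∈ s, (if e ∈ E then q e else 1 - q e)) =
    ∏ e ∈ s, (Real.exp 1 * q e + (1 - q e)) := by
  rw [Finset.prod_add, ← Finset.sum_subset (Finset.subset_univ s.powerset)]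
  · refine Finset.sum_congr rfl fun E hE => ?_
    have hEs := Finset.mem_powerset.1 hE
    rw [if_pos hEs, one_mul, Finset.prod_ite, Finset.prod_mul_distrib, Finset.prod_const,
      Finset.filter_mem_eq_inter, Finset.inter_eq_right.2 hEs, Finset.filter_notMem_eq_sdiff,
      ← Real.exp_nat_mul, mul_one, mul_assoc]
  · intro E _ hE
    rw [if_neg fun h => hE (Finset.mem_powerset.2 h), zero_mul, mul_zero]

/-- A Chernoff bound for the number of edges of a coloured random graph whose connection
probabilities are bounded by `b`. -/
theorem graphPr_card_gt_le {𝒳 : Type} [Fintype 𝒳] [DecidableEq 𝒳]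
    {μ : 𝒳 → ℝ} (hμ0 : ∀ a, 0 ≤ μ a) (hμs : ∑ a, μ a = 1)
    {p : 𝒳 → 𝒳 → ℝ} (hp0 : ∀ a b, 0 ≤ p a b) (hp1 : ∀ a b, p a b ≤ 1)
    {b : ℝ} (hb : 0 ≤ b) (hpb : ∀ i j, p i j ≤ b) (n : ℕ) (t : ℝ) :
    graphPr μ p n {x | t < (x.2.card : ℝ)} ≤ Real.exp (2 * b * (n : ℝ) ^ 2 - t) := by
  have hfac : ∀ i j, Real.exp 1 * p i j + (1 - p i j) ≤ Real.exp (2 * b) := fun i j => by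
    have h1 := Real.exp_one_lt_d9
    have h2 := Real.add_one_le_exp (2 * b)
    nlinarith [hp0 i j, hpb i j]
  have hcard : ((Edges n).card : ℝ) ≤ (n : ℝ) ^ 2 := by
    have h := Finset.card_le_univ (Edges n)
    rw [Fintype.card_prod, Fintype.card_fin, ← sq] at h
    exact_mod_cast h
  have hw : ∀ x, 0 ≤ graphWeight μ p n x := fun x => by
    refine mul_nonneg (mul_nonneg (by split_ifs <;> norm_num)
      (Finset.prod_nonneg fun v _ => hμ0 _)) (Finset.prod_nonneg fun e _ => ?_)
    split_ifs
    · exact hp0 _ _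
    · exact sub_nonneg.2 (hp1 _ _)
  calc graphPr μ p n {x | t < (x.2.card : ℝ)}
      ≤ ∑ x, Real.exp (-t) * (Real.exp x.2.card * graphWeight μ p n x) := by
        refine Finset.sum_le_sum fun x _ => Set.indicator_apply_le' (fun hx => ?_) (fun _ => ?_)
        · rw [← mul_assoc, ← Real.exp_add]
          refine le_mul_of_one_le_left (hw x) (Real.one_le_exp ?_)
          have : t < (x.2.card : ℝ) := hx
          linarith
        · exact mul_nonneg (Real.exp_pos _).le (mul_nonneg (Real.exp_pos _).le (hw x))
    _ = Real.exp (-t) * ∑ σ : Fin n → 𝒳, (∏ v, μ (σ v)) *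
          ∏ e ∈ Edges n, (Real.exp 1 * p (σ e.1) (σ e.2) + (1 - p (σ e.1) (σ e.2))) := by
        rw [← Finset.mul_sum, Fintype.sum_prod_type]
        congr 1
        refine Finset.sum_congr rfl fun σ _ => ?_
        rw [← sum_exp_card_mul_prod (Edges n) fun e => p (σ e.1) (σ e.2), Finset.mul_sum]
        refine Finset.sum_congr rfl fun E _ => ?_
        simp only [graphWeight]
        ring
    _ ≤ Real.exp (-t) * ∑ σ : Fin n → 𝒳, (∏ v, μ (σ v)) * Real.exp (2 * b * (n : ℝ) ^ 2) := by
        gcongr with σ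
        · exact Finset.prod_nonneg fun v _ => hμ0 _
        · calc _ ≤ ∏ _e ∈ Edges n, Real.exp (2 * b) :=
                Finset.prod_le_prod (fun e _ => add_nonneg
                  (mul_nonneg (Real.exp_pos _).le (hp0 _ _)) (sub_nonneg.2 (hp1 _ _)))
                  fun e _ => hfac _ _
            _ = Real.exp ((Edges n).card * (2 * b)) := by
                rw [Finset.prod_const, ← Real.exp_nat_mul]
            _ ≤ Real.exp (2 * b * (n : ℝ) ^ 2) := by
                rw [mul_comm]
                gcongr
    _ = Real.exp (2 * b * (n : ℝ) ^ 2 - t) := by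
        rw [← Finset.sum_mul, ← Fintype.sum_pow, hμs, one_pow, one_mul, ← Real.exp_add]
        congr 1
        ring

theorem coe_mul_elog_le {c x y : ℝ} (hc : 0 < c) (hx : x ≤ Real.exp y) :
    (c : EReal) * elog x ≤ ((c * y : ℝ) : EReal) := by
  unfold elog
  split_ifs with h
  · rw [EReal.coe_mul_bot_of_pos hc]
    exact bot_le
  · rw [← EReal.coe_mul, EReal.coe_le_coe_iff]
    exact mul_le_mul_of_nonneg_left ((Real.log_le_iff_le_exp (not_le.1 h)).2 hx) hc.le

end CRG

/-- **Exponential tightness lemma** (Lemma 3.4). For a coloured random graph with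
`aₙ⁻¹ pₙ(a,b) → C(a,b)` and `aₙ → 0` (`aₙ > 0`): for every `α > 0` there is `N ∈ ℕ`
with `limsup (1/(aₙ n²)) log ℙ{|E| > aₙ n² N} ≤ −α`. -/
theorem exponential_tightness_edges
    {𝒳 : Type} [Fintype 𝒳] [DecidableEq 𝒳] [Nonempty 𝒳]
    (μ : 𝒳 → ℝ) (hμ0 : ∀ a, 0 ≤ μ a) (hμs : ∑ a, μ a = 1)
    (p : ℕ → 𝒳 → 𝒳 → ℝ) (hp0 : ∀ n a b, 0 ≤ p n a b) (hp1 : ∀ n a b, p n a b ≤ 1)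
    (hpsymm : ∀ n a b, p n a b = p n b a)
    (C : 𝒳 → 𝒳 → ℝ) (hC0 : ∀ a b, 0 ≤ C a b) (hCsymm : ∀ a b, C a b = C b a)
    (a : ℕ → ℝ) (hapos : ∀ n, 0 < a n)
    (ha0 : Filter.Tendsto a Filter.atTop (nhds 0))
    (hconv : ∀ i j, Filter.Tendsto (fun n => p n i j / a n) Filter.atTop (nhds (C i j))) :
    ∀ α : ℝ, 0 < α → ∃ N : ℕ,
      Filter.limsup (fun n : ℕ => ((1 / (a n * (n:ℝ)^2) : ℝ) : EReal) *
          elog (graphPr μ (p n) n {x | a n * (n:ℝ)^2 * N < (x.2.card : ℝ)})) Filter.atTop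
        ≤ ((-α : ℝ) : EReal) := by
  intro α _
  obtain ⟨K, hK⟩ := (Set.finite_range fun q : 𝒳 × 𝒳 => C q.1 q.2).bddAbove
  have hCK : ∀ i j, C i j ≤ K := fun i j => hK ⟨(i, j), rfl⟩
  have hK0 : 0 ≤ K := (hC0 (Classical.arbitrary 𝒳) (Classical.arbitrary 𝒳)).trans (hCK _ _)
  obtain ⟨N, hN⟩ := exists_nat_ge (2 * (K + 1) + α)
  refine ⟨N, Filter.limsup_le_of_le (h := ?_)⟩
  have hev : ∀ᶠ n in atTop, ∀ i j, p n i j / a n ≤ K + 1 :=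
    eventually_all.2 fun i => eventually_all.2 fun j =>
      (hconv i j).eventually_le_const ((hCK i j).trans_lt (lt_add_one K))
  filter_upwards [hev, eventually_gt_atTop 0] with n hn hn0
  have han := hapos n
  have hpos : 0 < a n * (n : ℝ) ^ 2 := by positivity
  refine (coe_mul_elog_le (one_div_pos.2 hpos)
    (graphPr_card_gt_le hμ0 hμs (hp0 n) (hp1 n) (b := (K + 1) * a n) (by positivity)
      (fun i j => (div_le_iff₀ han).1 (hn i j)) n _)).trans ?_
  rw [EReal.coe_le_coe_iff, one_div, inv_mul_le_iff₀ hpos]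
  nlinarith
end
end

section
/- Let X be a coloured random graph with colour law μ : 𝒳 → (0,1] and connection probabilities p_n satisfying a_n^{-1}·p_n(a,b) → C(a,b) for all a,b ∈ 𝒳, for some symmetric C : 𝒳×𝒳 → [0,∞) and a sequence (a_n) with a_n → 0 and n·a_n → ∞. Define, for a probability measure ω on 𝒳 and a finite symmetric measure ϖ on 𝒳×𝒳, Î₂(ω,ϖ) = sup over functions f : 𝒳 → ℝ and symmetric functions g : 𝒳×𝒳 → ℝ of [ Σ_{a∈𝒳} (f(a) − U_f)·ω(a) + (1/2)·Σ_{a,b∈𝒳} g(a,b)·(ϖ(a,b) − C(a,b)·ω(a)·ω(b)) ], where U_f = log Σ_{a∈𝒳} e^{f(a)}·μ(a). Then for every closed set F ⊂ ℳ(𝒳)×ℳ̃_*(𝒳×𝒳), limsup_{n→∞} (1/n)·log ℙ{ (L¹, L²) ∈ F } ≤ −inf_{(ω,ϖ)∈F} Î₂(ω,ϖ). -/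
open Filter
open scoped ENNReal

noncomputable section

open CRG

/-- The variational functional `Î₂(ω,ϖ)` of Lemma 3.5, a supremum over functions
`f : 𝒳 → ℝ` and symmetric `g : 𝒳×𝒳 → ℝ`, with `U_f = log Σ_a e^(f a) μ(a)`. -/
def Ihat2 {𝒳 : Type} [Fintype 𝒳] (μ : 𝒳 → ℝ) (C : 𝒳 → 𝒳 → ℝ)
    (ω : 𝒳 → ℝ) (ϖ : 𝒳 × 𝒳 → ℝ) : EReal :=
  ⨆ (f : 𝒳 → ℝ), ⨆ (g : 𝒳 × 𝒳 → ℝ), ⨆ (_ : ∀ i j, g (i,j) = g (j,i)),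
    (((∑ i, (f i - Real.log (∑ j, Real.exp (f j) * μ j)) * ω i)
      + (1/2) * ∑ q : 𝒳 × 𝒳, g q * (ϖ q - C q.1 q.2 * ω q.1 * ω q.2) : ℝ) : EReal)

/-- The functional inside the supremum defining `Ihat2`, as a function of the pair `(ω, ϖ)`. -/
def tiltFunctional {𝒳 : Type} [Fintype 𝒳] (μ : 𝒳 → ℝ) (C : 𝒳 → 𝒳 → ℝ)
    (f : 𝒳 → ℝ) (g : 𝒳 × 𝒳 → ℝ) (z : (𝒳 → ℝ) × (𝒳 × 𝒳 → ℝ)) : ℝ :=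
  (∑ i, (f i - Real.log (∑ j, Real.exp (f j) * μ j)) * z.1 i)
    + (1/2) * ∑ q : 𝒳 × 𝒳, g q * (z.2 q - C q.1 q.2 * z.1 q.1 * z.1 q.2)

lemma continuous_tiltFunctional {𝒳 : Type} [Fintype 𝒳] (μ : 𝒳 → ℝ) (C : 𝒳 → 𝒳 → ℝ)
    (f : 𝒳 → ℝ) (g : 𝒳 × 𝒳 → ℝ) : Continuous (tiltFunctional μ C f g) := by
  unfold tiltFunctional
  fun_prop

lemma exists_lt_tiltFunctional {𝒳 : Type} [Fintype 𝒳] (μ : 𝒳 → ℝ) (C : 𝒳 → 𝒳 → ℝ)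
    (z : (𝒳 → ℝ) × (𝒳 × 𝒳 → ℝ)) (α : ℝ) (h : (α : EReal) < Ihat2 μ C z.1 z.2) :
    ∃ f : 𝒳 → ℝ, ∃ g : 𝒳 × 𝒳 → ℝ, (∀ i j, g (i, j) = g (j, i)) ∧
      α < tiltFunctional μ C f g z := by
  unfold Ihat2 at h
  simp only [lt_iSup_iff] at h
  obtain ⟨f, g, hg, h⟩ := h
  exact ⟨f, g, hg, by exact_mod_cast h⟩

/-- The sublevel sets of the functional with `f = 0`, `g = 1` are bounded in `MSpace`. -/
lemma isBounded_MSpace_inter_tiltFunctional_le {𝒳 : Type} [Fintype 𝒳] (μ : 𝒳 → ℝ)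
    (hμs : ∑ a, μ a = 1) (C : 𝒳 → 𝒳 → ℝ) (hC0 : ∀ a b, 0 ≤ C a b) (α : ℝ) :
    Bornology.IsBounded (MSpace 𝒳 ∩ {z | tiltFunctional μ C 0 1 z ≤ α}) := by
  refine (Metric.isBounded_Icc
    ((0, 0) : (𝒳 → ℝ) × (𝒳 × 𝒳 → ℝ))
    (fun _ => 1, fun _ => 2 * α + ∑ q : 𝒳 × 𝒳, C q.1 q.2)).subset ?_
  rintro ⟨ω, ϖ⟩ ⟨⟨hω0, hω1, hϖ0, -⟩, hα⟩
  dsimp only at hω0 hω1 hϖ0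
  have hω (i : 𝒳) : ω i ≤ 1 := by
    rw [← hω1]
    exact Finset.single_le_sum (fun i _ => hω0 i) (Finset.mem_univ i)
  refine ⟨⟨hω0, hϖ0⟩, ⟨hω, fun q => ?_⟩⟩
  have hq : ϖ q ≤ ∑ q, ϖ q := Finset.single_le_sum (fun i _ => hϖ0 i) (Finset.mem_univ q)
  have hC : ∑ q : 𝒳 × 𝒳, C q.1 q.2 * ω q.1 * ω q.2 ≤ ∑ q : 𝒳 × 𝒳, C q.1 q.2 := by
    refine Finset.sum_le_sum fun q _ => ?_
    rw [mul_assoc]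
    exact mul_le_of_le_one_right (hC0 _ _) (mul_le_one₀ (hω _) (hω0 _) (hω _))
  simp [tiltFunctional, hμs, Finset.sum_sub_distrib] at hα
  simp only
  linarith

lemma exists_finset_cover_tiltFunctional {𝒳 : Type} [Fintype 𝒳] (μ : 𝒳 → ℝ)
    (hμs : ∑ a, μ a = 1) (C : 𝒳 → 𝒳 → ℝ) (hC0 : ∀ a b, 0 ≤ C a b)
    (F : Set ((𝒳 → ℝ) × (𝒳 × 𝒳 → ℝ))) (hFM : F ⊆ MSpace 𝒳) (hF : IsClosed F) (α : ℝ)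
    (hα : ∀ z ∈ F, (α : EReal) < Ihat2 μ C z.1 z.2) :
    ∃ T : Finset ((𝒳 → ℝ) × (𝒳 × 𝒳 → ℝ)), (∀ t ∈ T, ∀ i j, t.2 (i, j) = t.2 (j, i)) ∧
      ∀ z ∈ F, ∃ t ∈ T, α ≤ tiltFunctional μ C t.1 t.2 z := by
  classical
  have hK : IsCompact (F ∩ {z | tiltFunctional μ C 0 1 z ≤ α}) :=
    Metric.isCompact_of_isClosed_isBounded
      (hF.inter (isClosed_le (continuous_tiltFunctional μ C 0 1) continuous_const))
      ((isBounded_MSpace_inter_tiltFunctional_le μ hμs C hC0 α).subset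
        (Set.inter_subset_inter_left _ hFM))
  obtain ⟨T, hT⟩ := hK.elim_finite_subcover
    (fun t : {t : (𝒳 → ℝ) × (𝒳 × 𝒳 → ℝ) // ∀ i j, t.2 (i, j) = t.2 (j, i)} =>
      {z | α < tiltFunctional μ C t.1.1 t.1.2 z})
    (fun t => isOpen_lt continuous_const (continuous_tiltFunctional μ C _ _))
    (by
      rintro z ⟨hz, -⟩
      obtain ⟨f, g, hg, h⟩ := exists_lt_tiltFunctional μ C z α (hα z hz)
      exact Set.mem_iUnion.2 ⟨⟨(f, g), hg⟩, h⟩)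
  refine ⟨insert (0, 1) (T.map (Function.Embedding.subtype _)), ?_, fun z hz => ?_⟩
  · intro t ht i j
    rcases Finset.mem_insert.1 ht with rfl | ht
    · rfl
    · obtain ⟨s, -, rfl⟩ := Finset.mem_map.1 ht
      exact s.2 i j
  · rcases le_total (tiltFunctional μ C 0 1 z) α with h | h
    · obtain ⟨t, ht, hzt⟩ := Set.mem_iUnion₂.1 (hT ⟨hz, h⟩)
      exact ⟨t.1, Finset.mem_insert_of_mem (Finset.mem_map.2 ⟨t, ht, rfl⟩), le_of_lt hzt⟩
    · exact ⟨(0, 1), Finset.mem_insert_self _ _, h⟩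

lemma tendsto_mul_exp_div_sub_one (c : ℝ) :
    Tendsto (fun t : ℝ => t * (Real.exp (c / t) - 1)) atTop (nhds c) := by
  have h : HasDerivAt (fun x : ℝ => Real.exp (c * x)) c 0 := by
    simpa using ((hasDerivAt_id (0 : ℝ)).const_mul c).exp
  have h2 := h.tendsto_slope_zero.comp
    (tendsto_inv_atTop_nhdsGT_zero.mono_right
      (nhdsWithin_mono 0 fun x (hx : 0 < x) => hx.ne'))
  refine h2.congr fun t => ?_
  simp [div_eq_mul_inv]

lemma two_mul_sum_Edges (n : ℕ) (H : Fin n → Fin n → ℝ) (hH : ∀ u v, H u v = H v u) :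
    2 * ∑ e ∈ Edges n, H e.1 e.2 + ∑ v, H v v = ∑ u, ∑ v, H u v := by
  have h1 : ∑ e ∈ Edges n, H e.1 e.2 = ∑ u, ∑ v, if u < v then H u v else 0 := by
    rw [Finset.sum_filter, ← Finset.univ_product_univ, Finset.sum_product]
  have h2 : ∑ e ∈ Edges n, H e.1 e.2 = ∑ u, ∑ v, if v < u then H u v else 0 := by
    rw [h1, Finset.sum_comm]
    simp only [hH]
  have h3 : ∑ v, H v v = ∑ u, ∑ v, if u = v then H u v else 0 := by simp
  rw [two_mul]
  nth_rw 1 [h1]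
  rw [h2, h3]
  simp only [← Finset.sum_add_distrib]
  refine Finset.sum_congr rfl fun u _ => Finset.sum_congr rfl fun v _ => ?_
  rcases lt_trichotomy u v with h | h | h
  · simp [h, h.not_gt, h.ne]
  · simp [h]
  · simp [h, h.not_gt, h.ne']

lemma graphWeight_nonneg {𝒳 : Type} (μ : 𝒳 → ℝ) (hμ0 : ∀ a, 0 < μ a) (p : 𝒳 → 𝒳 → ℝ)
    (hp0 : ∀ a b, 0 ≤ p a b) (hp1 : ∀ a b, p a b ≤ 1) (n : ℕ)
    (x : (Fin n → 𝒳) × Finset (Fin n × Fin n)) : 0 ≤ graphWeight μ p n x := by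
  unfold graphWeight
  refine mul_nonneg (mul_nonneg (by split_ifs <;> norm_num)
    (Finset.prod_nonneg fun v _ => (hμ0 _).le)) (Finset.prod_nonneg fun e _ => ?_)
  split_ifs
  · exact hp0 _ _
  · exact sub_nonneg.2 (hp1 _ _)

lemma sum_prod_colour_tilt {𝒳 : Type} [Fintype 𝒳] [Nonempty 𝒳] (μ : 𝒳 → ℝ) (hμ0 : ∀ a, 0 < μ a) (f : 𝒳 → ℝ) (n : ℕ) :
    ∑ c : Fin n → 𝒳, (∏ v, μ (c v)) *
      Real.exp (∑ v, (f (c v) - Real.log (∑ j, Real.exp (f j) * μ j))) = 1 := by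
  have hS : 0 < ∑ j, Real.exp (f j) * μ j :=
    Finset.sum_pos (fun j _ => mul_pos (Real.exp_pos _) (hμ0 j)) Finset.univ_nonempty
  simp_rw [Real.exp_sum, ← Finset.prod_mul_distrib]
  rw [← Fintype.piFinset_univ, ← Finset.prod_univ_sum (fun _ => Finset.univ)
    (fun _ i => μ i * Real.exp (f i - Real.log (∑ j, Real.exp (f j) * μ j)))]
  refine Finset.prod_eq_one fun _ _ => ?_
  simp_rw [Real.exp_sub, Real.exp_log hS, mul_div_assoc', ← Finset.sum_div]
  rw [div_eq_one_iff_eq hS.ne']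
  exact Finset.sum_congr rfl fun i _ => mul_comm _ _

/-- Summing out the edges of the random graph for a fixed colouring. -/
lemma sum_graphWeight_mul_prod {𝒳 : Type} (μ : 𝒳 → ℝ) (p : 𝒳 → 𝒳 → ℝ) (n : ℕ) (c : Fin n → 𝒳)
    (w : Fin n × Fin n → ℝ) :
    ∑ E, graphWeight μ p n (c, E) * ∏ e ∈ E, w e
      = (∏ v, μ (c v)) * ∏ e ∈ Edges n, (1 + p (c e.1) (c e.2) * (w e - 1)) := by
  have h1 : ∏ e ∈ Edges n, (1 + p (c e.1) (c e.2) * (w e - 1))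
      = ∏ e ∈ Edges n, (p (c e.1) (c e.2) * w e + (1 - p (c e.1) (c e.2))) :=
    Finset.prod_congr rfl fun e _ => by ring
  rw [h1, Finset.prod_add, Finset.mul_sum,
    ← Finset.sum_subset (Finset.subset_univ (Edges n).powerset)]
  · refine Finset.sum_congr rfl fun E hE => ?_
    rw [Finset.mem_powerset] at hE
    have h2 : (Edges n).filter (· ∈ E) = E := by
      ext e
      rw [Finset.mem_filter]
      exact ⟨fun h => h.2, fun h => ⟨hE h, h⟩⟩
    have h3 : (Edges n).filter (¬ · ∈ E) = Edges n \ E := by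
      ext e
      simp [Finset.mem_sdiff]
    simp only [graphWeight, if_pos hE, one_mul]
    rw [Finset.prod_ite, h2, h3, Finset.prod_mul_distrib]
    ring
  · intro E _ hE
    rw [Finset.mem_powerset] at hE
    simp [graphWeight, hE]

lemma eventually_edge_contribution_le {𝒳 : Type} [Fintype 𝒳]
    (p : ℕ → 𝒳 → 𝒳 → ℝ) (C : 𝒳 → 𝒳 → ℝ) (hCsymm : ∀ a b, C a b = C b a)
    (a : ℕ → ℝ) (hapos : ∀ n, 0 < a n)
    (hconv : ∀ i j, Tendsto (fun n => p n i j / a n) atTop (nhds (C i j)))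
    (hna : Tendsto (fun n : ℕ => (n : ℝ) * a n) atTop atTop)
    (g : 𝒳 × 𝒳 → ℝ) (hg : ∀ i j, g (i, j) = g (j, i)) (ε : ℝ) (hε : 0 < ε) :
    ∀ᶠ n : ℕ in atTop, ∀ c : Fin n → 𝒳,
      ∑ e ∈ Edges n, p n (c e.1) (c e.2) * (Real.exp (g (c e.1, c e.2) / (n * a n)) - 1)
        - (∑ u, ∑ v, g (c u, c v) * C (c u) (c v)) / (2 * n) ≤ ε * n := by
  have hlim (i j : 𝒳) : Tendsto
      (fun n : ℕ => (n : ℝ) * (p n i j * (Real.exp (g (i, j) / (n * a n)) - 1))) atTop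
      (nhds (g (i, j) * C i j)) := by
    rw [mul_comm]
    refine ((hconv i j).mul ((tendsto_mul_exp_div_sub_one (g (i, j))).comp hna)).congr fun n => ?_
    have := (hapos n).ne'
    simp only [Function.comp_apply]
    field_simp
  have hev : ∀ᶠ n : ℕ in atTop, ∀ i j : 𝒳,
      (n : ℝ) * (p n i j * (Real.exp (g (i, j) / (n * a n)) - 1)) ≤ g (i, j) * C i j + ε :=
    eventually_all.2 fun i => eventually_all.2 fun j =>
      (hlim i j).eventually_le_const (lt_add_of_pos_right _ hε)
  set M : ℝ := ∑ i, |g (i, i) * C i i|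
  have hM (i : 𝒳) : -M ≤ g (i, i) * C i i :=
    (neg_le_neg (Finset.single_le_sum (f := fun i => |g (i, i) * C i i|)
      (fun i _ => abs_nonneg _) (Finset.mem_univ i))).trans (neg_abs_le _)
  have hbig : ∀ᶠ n : ℕ in atTop, M / ε ≤ n :=
    tendsto_natCast_atTop_atTop.eventually_ge_atTop _
  filter_upwards [hev, hbig, eventually_gt_atTop 0] with n h1 h2 h3 c
  have hn : (0 : ℝ) < n := by exact_mod_cast h3
  rw [div_le_iff₀ hε] at h2
  have hsum := two_mul_sum_Edges n (fun u v => g (c u, c v) * C (c u) (c v) + ε)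
    (fun u v => by rw [hg, hCsymm])
  simp only [Finset.sum_add_distrib, Finset.sum_const, Finset.card_univ, Fintype.card_fin,
    nsmul_eq_mul] at hsum
  have hdiag : -(n * M) ≤ ∑ v, g (c v, c v) * C (c v) (c v) := by
    have := Finset.sum_le_sum (s := Finset.univ) fun (v : Fin n) _ => hM (c v)
    simpa using this
  have hedge : n * ∑ e ∈ Edges n,
        p n (c e.1) (c e.2) * (Real.exp (g (c e.1, c e.2) / (n * a n)) - 1)
      ≤ ∑ e ∈ Edges n, g (c e.1, c e.2) * C (c e.1) (c e.2) + ((Edges n).card : ℝ) * ε := by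
    rw [Finset.mul_sum, ← nsmul_eq_mul (Edges n).card, ← Finset.sum_const, ← Finset.sum_add_distrib]
    exact Finset.sum_le_sum fun e _ => h1 _ _
  refine le_of_mul_le_mul_left ?_ hn
  rw [mul_sub]
  have hdiv : (n : ℝ) * ((∑ u, ∑ v, g (c u, c v) * C (c u) (c v)) / (2 * n))
      = (∑ u, ∑ v, g (c u, c v) * C (c u) (c v)) / 2 := by
    field_simp
  rw [hdiv]
  nlinarith

section

variable {𝒳 : Type} [Fintype 𝒳] [DecidableEq 𝒳]

lemma sum_mul_L1 (n : ℕ) (hn : n ≠ 0) (x : (Fin n → 𝒳) × Finset (Fin n × Fin n)) (F : 𝒳 → ℝ) :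
    (n : ℝ) * ∑ i, F i * L1 n x i = ∑ v, F (x.1 v) := by
  have hn' : (n : ℝ) ≠ 0 := by exact_mod_cast hn
  rw [← Finset.sum_fiberwise_of_maps_to (t := Finset.univ) (g := x.1) (fun _ _ => Finset.mem_univ _),
    Finset.mul_sum]
  refine Finset.sum_congr rfl fun i _ => ?_
  rw [Finset.sum_congr rfl (g := fun _ => F i) (by simp +contextual), Finset.sum_const, L1,
    nsmul_eq_mul]
  field_simp

lemma sum_mul_L1_mul_L1 (n : ℕ) (hn : n ≠ 0) (x : (Fin n → 𝒳) × Finset (Fin n × Fin n))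
    (G : 𝒳 → 𝒳 → ℝ) :
    (n : ℝ) ^ 2 * ∑ q : 𝒳 × 𝒳, G q.1 q.2 * L1 n x q.1 * L1 n x q.2
      = ∑ u, ∑ v, G (x.1 u) (x.1 v) := by
  rw [← sum_mul_L1 n hn x (fun i => ∑ v, G i (x.1 v))]
  simp_rw [← sum_mul_L1 n hn x]
  rw [Fintype.sum_prod_type, sq, mul_assoc, Finset.mul_sum]
  congr 1
  refine Finset.sum_congr rfl fun i _ => ?_
  rw [mul_assoc, Finset.sum_mul]
  congr 1
  exact Finset.sum_congr rfl fun j _ => by ring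

lemma sum_mul_L2 (an : ℝ) (n : ℕ) (x : (Fin n → 𝒳) × Finset (Fin n × Fin n))
    (g : 𝒳 × 𝒳 → ℝ) (hg : ∀ i j, g (i, j) = g (j, i)) :
    ∑ q, g q * L2 an n x q = 2 * (∑ e ∈ x.2, g (x.1 e.1, x.1 e.2)) / ((n : ℝ) ^ 2 * an) := by
  simp only [L2, mul_div_assoc', ← Finset.sum_div]
  congr 1
  simp_rw [Finset.mul_sum]
  rw [Finset.sum_comm]
  refine Finset.sum_congr rfl fun e _ => ?_
  simp [mul_add, Finset.sum_add_distrib, hg (x.1 e.2)]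
  ring

lemma mul_tiltFunctional_L1_L2 (μ : 𝒳 → ℝ) (C : 𝒳 → 𝒳 → ℝ) (f : 𝒳 → ℝ) (g : 𝒳 × 𝒳 → ℝ)
    (hg : ∀ i j, g (i, j) = g (j, i)) (an : ℝ) (n : ℕ) (hn : n ≠ 0)
    (x : (Fin n → 𝒳) × Finset (Fin n × Fin n)) :
    (n : ℝ) * tiltFunctional μ C f g (L1 n x, L2 an n x)
      = ∑ v, (f (x.1 v) - Real.log (∑ j, Real.exp (f j) * μ j))
        + ∑ e ∈ x.2, g (x.1 e.1, x.1 e.2) / (n * an)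
        - (∑ u, ∑ v, g (x.1 u, x.1 v) * C (x.1 u) (x.1 v)) / (2 * n) := by
  have hn' : (n : ℝ) ≠ 0 := by exact_mod_cast hn
  rw [← sum_mul_L1 n hn x (fun i => f i - Real.log (∑ j, Real.exp (f j) * μ j)),
    ← sum_mul_L1_mul_L1 n hn x (fun i j => g (i, j) * C i j), ← Finset.sum_div]
  simp only [tiltFunctional, mul_sub, Finset.sum_sub_distrib, sum_mul_L2 an n x g hg, mul_add,
    mul_assoc]
  rw [add_sub_assoc]
  congr 1
  congr 1
  · field_simp
  · field_simp

/-- The exponential moment of the functional is bounded once the edge contribution is bounded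
uniformly over colourings. -/
lemma sum_graphWeight_mul_exp_le [Nonempty 𝒳] (μ : 𝒳 → ℝ) (hμ0 : ∀ a, 0 < μ a)
    (p : 𝒳 → 𝒳 → ℝ) (hp0 : ∀ a b, 0 ≤ p a b) (hp1 : ∀ a b, p a b ≤ 1)
    (C : 𝒳 → 𝒳 → ℝ) (f : 𝒳 → ℝ) (g : 𝒳 × 𝒳 → ℝ) (hg : ∀ i j, g (i, j) = g (j, i))
    (an : ℝ) (n : ℕ) (hn : n ≠ 0) (K : ℝ)
    (hK : ∀ c : Fin n → 𝒳,
      ∑ e ∈ Edges n, p (c e.1) (c e.2) * (Real.exp (g (c e.1, c e.2) / (n * an)) - 1)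
        - (∑ u, ∑ v, g (c u, c v) * C (c u) (c v)) / (2 * n) ≤ K) :
    ∑ x, graphWeight μ p n x * Real.exp (n * tiltFunctional μ C f g (L1 n x, L2 an n x))
      ≤ Real.exp K := by
  rw [Fintype.sum_prod_type]
  simp_rw [mul_tiltFunctional_L1_L2 μ C f g hg an n hn]
  calc
    _ ≤ ∑ c : Fin n → 𝒳, (∏ v, μ (c v)) *
        Real.exp (∑ v, (f (c v) - Real.log (∑ j, Real.exp (f j) * μ j))) * Real.exp K := by
      refine Finset.sum_le_sum fun c _ => ?_
      set A := ∑ v, (f (c v) - Real.log (∑ j, Real.exp (f j) * μ j))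
      set B := (∑ u, ∑ v, g (c u, c v) * C (c u) (c v)) / (2 * n)
      have h1 (E : Finset (Fin n × Fin n)) :
          graphWeight μ p n (c, E) * Real.exp (A + ∑ e ∈ E, g (c e.1, c e.2) / (n * an) - B)
            = (graphWeight μ p n (c, E) * ∏ e ∈ E, Real.exp (g (c e.1, c e.2) / (n * an)))
              * Real.exp (A - B) := by
        rw [← Real.exp_sum, mul_assoc, ← Real.exp_add]
        congr 2
        ring
      rw [Finset.sum_congr rfl fun E _ => h1 E, ← Finset.sum_mul,
        sum_graphWeight_mul_prod, mul_assoc, mul_assoc]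
      refine mul_le_mul_of_nonneg_left ?_ (Finset.prod_nonneg fun v _ => (hμ0 _).le)
      calc
        _ ≤ (∏ e ∈ Edges n, Real.exp
              (p (c e.1) (c e.2) * (Real.exp (g (c e.1, c e.2) / (n * an)) - 1)))
              * Real.exp (A - B) := by
          refine mul_le_mul_of_nonneg_right
            (Finset.prod_le_prod (fun e _ => ?_) fun e _ => ?_) (Real.exp_pos _).le
          · nlinarith [hp0 (c e.1) (c e.2), hp1 (c e.1) (c e.2),
              mul_nonneg (hp0 (c e.1) (c e.2)) (Real.exp_pos (g (c e.1, c e.2) / (n * an))).le]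
          · rw [add_comm]
            exact Real.add_one_le_exp _
        _ ≤ _ := by
          rw [← Real.exp_sum, ← Real.exp_add, ← Real.exp_add]
          refine Real.exp_le_exp.2 ?_
          linarith [hK c]
    _ = _ := by rw [← Finset.sum_mul, sum_prod_colour_tilt μ hμ0, one_mul]

lemma graphPr_le_sum_exp (μ : 𝒳 → ℝ) (hμ0 : ∀ a, 0 < μ a) (p : 𝒳 → 𝒳 → ℝ)
    (hp0 : ∀ a b, 0 ≤ p a b) (hp1 : ∀ a b, p a b ≤ 1) (C : 𝒳 → 𝒳 → ℝ) (an : ℝ) (n : ℕ)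
    (F : Set ((𝒳 → ℝ) × (𝒳 × 𝒳 → ℝ))) (α : ℝ) (T : Finset ((𝒳 → ℝ) × (𝒳 × 𝒳 → ℝ)))
    (hT : ∀ z ∈ F, ∃ t ∈ T, α ≤ tiltFunctional μ C t.1 t.2 z) :
    graphPr μ p n {x | (L1 n x, L2 an n x) ∈ F}
      ≤ Real.exp (-(n * α)) * ∑ t ∈ T, ∑ x, graphWeight μ p n x *
        Real.exp (n * tiltFunctional μ C t.1 t.2 (L1 n x, L2 an n x)) := by
  rw [Finset.sum_comm, Finset.mul_sum, graphPr]
  refine Finset.sum_le_sum fun x _ => ?_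
  have hw := graphWeight_nonneg μ hμ0 p hp0 hp1 n x
  have hnonneg (t : (𝒳 → ℝ) × (𝒳 × 𝒳 → ℝ)) : 0 ≤ graphWeight μ p n x *
      Real.exp (n * tiltFunctional μ C t.1 t.2 (L1 n x, L2 an n x)) :=
    mul_nonneg hw (Real.exp_pos _).le
  by_cases hx : (L1 n x, L2 an n x) ∈ F
  · rw [Set.indicator_of_mem (by exact hx)]
    obtain ⟨t, ht, hα⟩ := hT _ hx
    calc
      graphWeight μ p n x
          = Real.exp (-(n * α)) * (graphWeight μ p n x * Real.exp (n * α)) := by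
        rw [mul_left_comm, ← Real.exp_add]
        simp
      _ ≤ Real.exp (-(n * α)) * (graphWeight μ p n x *
          Real.exp (n * tiltFunctional μ C t.1 t.2 (L1 n x, L2 an n x))) := by
        gcongr
      _ ≤ _ := by
        gcongr
        exact Finset.single_le_sum (fun t _ => hnonneg t) ht
  · rw [Set.indicator_of_notMem (by exact hx)]
    exact mul_nonneg (Real.exp_pos _).le (Finset.sum_nonneg fun t _ => hnonneg t)

lemma inv_mul_elog_le {n : ℕ} (hn : 0 < n) {x r : ℝ} (hx : x ≤ Real.exp (n * r)) :
    ((1 / (n : ℝ) : ℝ) : EReal) * elog x ≤ (r : EReal) := by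
  have hn' : (0 : ℝ) < n := by exact_mod_cast hn
  unfold elog
  split_ifs with h
  · rw [EReal.coe_mul_bot_of_pos (by positivity)]
    exact bot_le
  · rw [← EReal.coe_mul, EReal.coe_le_coe_iff, one_div, inv_mul_le_iff₀ hn']
    exact (Real.log_le_iff_le_exp (not_le.1 h)).2 hx

end

/-- **Upper bound in Theorem 2.4(ii)** (Lemma 3.5): for the supercritical coloured random
graph, for every closed `F ⊆ ℳ(𝒳) × ℳ̃_*(𝒳×𝒳)`,
`limsup (1/n) log ℙ{(L¹,L²) ∈ F} ≤ −inf_F Î₂`. -/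
theorem upper_bound_speed_n_supercritical
    {𝒳 : Type} [Fintype 𝒳] [DecidableEq 𝒳] [Nonempty 𝒳]
    (μ : 𝒳 → ℝ) (hμ0 : ∀ a, 0 < μ a) (hμ1 : ∀ a, μ a ≤ 1) (hμs : ∑ a, μ a = 1)
    (p : ℕ → 𝒳 → 𝒳 → ℝ) (hp0 : ∀ n a b, 0 ≤ p n a b) (hp1 : ∀ n a b, p n a b ≤ 1)
    (hpsymm : ∀ n a b, p n a b = p n b a)
    (C : 𝒳 → 𝒳 → ℝ) (hC0 : ∀ a b, 0 ≤ C a b) (hCsymm : ∀ a b, C a b = C b a)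
    (a : ℕ → ℝ) (hapos : ∀ n, 0 < a n)
    (hconv : ∀ i j, Filter.Tendsto (fun n => p n i j / a n) Filter.atTop (nhds (C i j)))
    (ha0 : Filter.Tendsto a Filter.atTop (nhds 0))
    (hna : Filter.Tendsto (fun n : ℕ => (n : ℝ) * a n) Filter.atTop Filter.atTop)
    :
    ∀ F : Set ((𝒳 → ℝ) × (𝒳 × 𝒳 → ℝ)), F ⊆ MSpace 𝒳 → IsClosed F →
      Filter.limsup (fun n : ℕ => ((1 / (n:ℝ) : ℝ) : EReal) *
          elog (graphPr μ (p n) n {x | (L1 n x, L2 (a n) n x) ∈ F})) Filter.atTop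
        ≤ - ⨅ z ∈ F, Ihat2 μ C z.1 z.2 := by
  intro F hFM hF
  refine EReal.le_neg_of_le_neg (EReal.ge_of_forall_gt_iff_ge.1 fun α hα => ?_)
  refine EReal.le_neg_of_le_neg (EReal.le_of_forall_lt_iff_le.1 fun β hβ => ?_)
  rw [← EReal.coe_neg, EReal.coe_lt_coe_iff] at hβ
  obtain ⟨T, hTs, hT⟩ := exists_finset_cover_tiltFunctional μ hμs C hC0 F hFM hF α
    fun z hz => hα.trans_le (iInf₂_le z hz)
  obtain ⟨ε, hε, hεβ⟩ : ∃ ε : ℝ, 0 < ε ∧ -α + 2 * ε = β := ⟨(β + α) / 2, by linarith, by ring⟩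
  have hmom : ∀ᶠ n : ℕ in atTop, ∀ t ∈ T, ∑ x, graphWeight μ (p n) n x *
      Real.exp (n * tiltFunctional μ C t.1 t.2 (L1 n x, L2 (a n) n x)) ≤ Real.exp (ε * n) := by
    rw [Filter.eventually_all_finset]
    intro t ht
    filter_upwards [eventually_edge_contribution_le p C hCsymm a hapos hconv hna t.2 (hTs t ht)
      ε hε, eventually_ne_atTop 0] with n h1 h2
    exact sum_graphWeight_mul_exp_le μ hμ0 (p n) (hp0 n) (hp1 n) C t.1 t.2 (hTs t ht) (a n) n h2
      _ h1
  have hcard : ∀ᶠ n : ℕ in atTop, (T.card : ℝ) ≤ Real.exp (ε * n) :=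
    (Real.tendsto_exp_atTop.comp
      (tendsto_natCast_atTop_atTop.const_mul_atTop hε)).eventually_ge_atTop _
  refine Filter.limsup_le_of_le (h := ?_)
  filter_upwards [hmom, hcard, eventually_gt_atTop 0] with n h1 h2 h3
  refine inv_mul_elog_le h3 ?_
  calc
    _ ≤ _ := graphPr_le_sum_exp μ hμ0 (p n) (hp0 n) (hp1 n) C (a n) n F α T hT
    _ ≤ Real.exp (-(n * α)) * (Real.exp (ε * n) * Real.exp (ε * n)) := by
      gcongr
      refine (Finset.sum_le_card_nsmul _ _ _ h1).trans ?_
      rw [nsmul_eq_mul]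
      gcongr
    _ = Real.exp (n * β) := by
      rw [← Real.exp_add, ← Real.exp_add, ← hεβ]
      congr 1
      ring
end
end
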